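/- Let {(~μ_t, μ_t) : t ≥ 0} be a two-state free convolution semigroup of compactly supported probability measures such that ~μ_1 has non-zero variance. Then there exist p > 0 and probability measures ω, ~ρ on ℝ such that ω ⊳ ~ρ is ⊞-infinitely divisible, μ_t = (ω ⊳ ~ρ)^{⊞(t/p)} for all t ≥ 0, and J[~μ_t] = ~ρ ⊞ ω^{⊞(t/p)} (the probability measure with Voiculescu transform φ_{~ρ} + (t/p)φ_ω) for all t > 0. -/

import Mathlib

open MeasureTheory Complex

noncomputable section

/-- The Cauchy transform `G_μ(z) = ∫ 1/(z - x) dμ(x)` of a measure on `ℝ`. -/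
def cauchyG (μ : Measure ℝ) (z : ℂ) : ℂ := ∫ x : ℝ, (z - (x : ℂ))⁻¹ ∂μ

/-- The F-transform `F_μ = 1/G_μ`. -/
def Ftr (μ : Measure ℝ) (z : ℂ) : ℂ := (cauchyG μ z)⁻¹

/-- The open upper half-plane `ℂ⁺`. -/
def UHP : Set ℂ := {z : ℂ | 0 < z.im}

/-- The truncated cone `Γ_{α,M} = {z ∈ ℂ⁺ : |Re z| < α · Im z, Im z > M}`. -/
def tcone (α M : ℝ) : Set ℂ := {z : ℂ | |z.re| < α * z.im ∧ M < z.im}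

/-- `φ` is a Voiculescu transform of `μ`: `φ(F_μ(z)) + F_μ(z) = z` on some truncated cone. -/
def IsVT (μ : Measure ℝ) (φ : ℂ → ℂ) : Prop :=
  ∃ α M : ℝ, 0 < α ∧ 0 < M ∧ ∀ z ∈ tcone α M, φ (Ftr μ z) + Ftr μ z = z

/-- `ψ` is a two-state Voiculescu transform of the pair `(μt, μ)`:
`ψ(F_μ(z)) + F_{μt}(z) = z` on some truncated cone. -/
def IsTwoStateVT (μt μ : Measure ℝ) (ψ : ℂ → ℂ) : Prop :=
  ∃ α M : ℝ, 0 < α ∧ 0 < M ∧ ∀ z ∈ tcone α M, ψ (Ftr μ z) + Ftr μt z = z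

/-- `μ` is freely infinitely divisible: some Voiculescu transform `φ` of `μ` is such that
`t·φ` is a Voiculescu transform of a probability measure for every `t ≥ 0`. -/
def IsFID (μ : Measure ℝ) : Prop :=
  ∃ φ : ℂ → ℂ, IsVT μ φ ∧ ∀ t : ℝ, 0 ≤ t →
    ∃ ν : Measure ℝ, IsProbabilityMeasure ν ∧ IsVT ν (fun z => (t : ℂ) * φ z)

/-- The semicircular distribution with mean `β` and variance `γ` (Dirac mass at `β` for `γ = 0`). -/
def semicircle (β γ : ℝ) : Measure ℝ :=
  if γ = 0 then Measure.dirac β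
  else volume.withDensity
    (fun x => ENNReal.ofReal ((2 * Real.pi * γ)⁻¹ * Real.sqrt (4 * γ - (x - β) ^ 2)))

section CauchyTransform

open Filter Topology Bornology

lemma notMem_support_image {μ : Measure ℝ} {z : ℂ} (hz : z.im ≠ 0) :
    z ∉ algebraMap ℝ ℂ '' μ.support := by
  rintro ⟨x, -, rfl⟩
  simp at hz

lemma cauchyG_eq_neg_resolventTransform (μ : Measure ℝ) (z : ℂ) :
    cauchyG μ z = -resolventTransform μ z := by
  rw [cauchyG, resolventTransform_apply, ← integral_neg]
  congr 1
  ext x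
  rw [resolvent, Ring.inverse_eq_inv', ← inv_neg, neg_sub]
  rfl

lemma sub_ofReal_ne_zero {z : ℂ} (hz : z.im ≠ 0) (x : ℝ) : z - x ≠ 0 := by
  intro h
  apply hz
  simpa using congrArg Complex.im h

lemma norm_inv_sub_le {z : ℂ} (hz : 0 < z.im) (x : ℝ) : ‖(z - (x : ℂ))⁻¹‖ ≤ z.im⁻¹ := by
  rw [norm_inv]
  apply inv_anti₀ hz
  calc z.im = |(z - x).im| := by simp [abs_of_pos hz]
    _ ≤ _ := Complex.abs_im_le_norm _

lemma continuous_inv_sub {z : ℂ} (hz : z.im ≠ 0) : Continuous fun x : ℝ => (z - (x : ℂ))⁻¹ :=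
  Continuous.inv₀ (by fun_prop) (sub_ofReal_ne_zero hz)

lemma integrable_inv_sub (μ : Measure ℝ) [IsFiniteMeasure μ] {z : ℂ} (hz : 0 < z.im) :
    Integrable (fun x : ℝ => (z - (x : ℂ))⁻¹) μ :=
  Integrable.of_bound (continuous_inv_sub hz.ne').aestronglyMeasurable z.im⁻¹
    (ae_of_all _ (norm_inv_sub_le hz))

lemma isOpen_UHP : IsOpen UHP := isOpen_lt continuous_const Complex.continuous_im

lemma convex_im_gt (K : ℝ) : Convex ℝ {z : ℂ | K < z.im} := by
  simpa using convex_halfSpace_im_gt K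

lemma isPreconnected_UHP : IsPreconnected UHP := (convex_im_gt 0).isPreconnected

lemma differentiableAt_cauchyG (μ : Measure ℝ) [IsFiniteMeasure μ] {z : ℂ} (hz : z.im ≠ 0) :
    DifferentiableAt ℂ (cauchyG μ) z := by
  have h : cauchyG μ = fun z => -resolventTransform μ z :=
    funext (cauchyG_eq_neg_resolventTransform μ)
  rw [h]
  exact (hasDerivAt_resolventTransform z (notMem_support_image hz)).differentiableAt.neg

lemma differentiableOn_cauchyG (μ : Measure ℝ) [IsFiniteMeasure μ] :
    DifferentiableOn ℂ (cauchyG μ) UHP :=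
  fun _ hz => (differentiableAt_cauchyG μ (ne_of_gt hz)).differentiableWithinAt

lemma inv_sub_im (z : ℂ) (x : ℝ) :
    ((z - (x : ℂ))⁻¹).im = -(z.im * ‖(z - (x : ℂ))⁻¹‖ ^ 2) := by
  rw [Complex.inv_im, norm_inv, inv_pow, Complex.normSq_eq_norm_sq]
  simp [div_eq_mul_inv]

lemma integrable_norm_inv_sub_sq (μ : Measure ℝ) [IsFiniteMeasure μ] {z : ℂ} (hz : 0 < z.im) :
    Integrable (fun x : ℝ => ‖(z - (x : ℂ))⁻¹‖ ^ 2) μ := by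
  refine Integrable.of_bound
    ((continuous_inv_sub hz.ne').norm.pow 2).aestronglyMeasurable (z.im⁻¹ ^ 2)
    (ae_of_all _ fun x => ?_)
  rw [norm_pow, norm_norm]
  exact pow_le_pow_left₀ (norm_nonneg _) (norm_inv_sub_le hz x) 2

lemma cauchyG_im (μ : Measure ℝ) [IsFiniteMeasure μ] {z : ℂ} (hz : 0 < z.im) :
    (cauchyG μ z).im = -(z.im * ∫ x : ℝ, ‖(z - (x : ℂ))⁻¹‖ ^ 2 ∂μ) := by
  have h := integral_im (integrable_inv_sub μ hz)
  simp only [RCLike.im_eq_complex_im] at h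
  rw [cauchyG, ← h, ← integral_const_mul, ← integral_neg]
  simp_rw [inv_sub_im]

lemma norm_cauchyG_le (μ : Measure ℝ) [IsProbabilityMeasure μ] {z : ℂ} (hz : 0 < z.im) :
    ‖cauchyG μ z‖ ≤ z.im⁻¹ := by
  have := norm_integral_le_of_norm_le_const (μ := μ) (ae_of_all _ (norm_inv_sub_le hz))
  simpa [cauchyG] using this

/-- Jensen's inequality for the squared norm. -/
lemma norm_cauchyG_sq_le (μ : Measure ℝ) [IsProbabilityMeasure μ] {z : ℂ} (hz : 0 < z.im) :
    ‖cauchyG μ z‖ ^ 2 ≤ ∫ x : ℝ, ‖(z - (x : ℂ))⁻¹‖ ^ 2 ∂μ := by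
  have h1 := integrable_norm_inv_sub_sq μ hz
  have h2 := (integrable_inv_sub μ hz).norm
  set c := ∫ x : ℝ, ‖(z - (x : ℂ))⁻¹‖ ∂μ with hc
  have h3 : ‖cauchyG μ z‖ ≤ c := norm_integral_le_integral_norm _
  have h4 : 0 ≤ ∫ x : ℝ, (‖(z - (x : ℂ))⁻¹‖ - c) ^ 2 ∂μ := integral_nonneg fun x => sq_nonneg _
  have h5 : ∫ x : ℝ, (‖(z - (x : ℂ))⁻¹‖ - c) ^ 2 ∂μ
      = (∫ x : ℝ, ‖(z - (x : ℂ))⁻¹‖ ^ 2 ∂μ) - c ^ 2 := by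
    have : ∀ x : ℝ, (‖(z - (x : ℂ))⁻¹‖ - c) ^ 2
        = ‖(z - (x : ℂ))⁻¹‖ ^ 2 - (2 * c) * ‖(z - (x : ℂ))⁻¹‖ + c ^ 2 := fun x => by ring
    have hi : Integrable
        (fun x : ℝ => ‖(z - (x : ℂ))⁻¹‖ ^ 2 - (2 * c) * ‖(z - (x : ℂ))⁻¹‖) μ :=
      h1.sub (h2.const_mul _)
    simp_rw [this]
    rw [integral_add hi (integrable_const _),
      integral_sub h1 (h2.const_mul _), integral_const_mul, ← hc]
    simp
    ring
  nlinarith [norm_nonneg (cauchyG μ z)]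

lemma integral_norm_inv_sub_sq_pos (μ : Measure ℝ) [IsProbabilityMeasure μ] {z : ℂ}
    (hz : 0 < z.im) : 0 < ∫ x : ℝ, ‖(z - (x : ℂ))⁻¹‖ ^ 2 ∂μ := by
  rw [integral_pos_iff_support_of_nonneg (fun x => sq_nonneg _) (integrable_norm_inv_sub_sq μ hz)]
  have : (Function.support fun x : ℝ => ‖(z - (x : ℂ))⁻¹‖ ^ 2) = Set.univ := by
    ext x
    simpa using sub_ofReal_ne_zero hz.ne' x
  rw [this]
  simp

lemma cauchyG_im_neg (μ : Measure ℝ) [IsProbabilityMeasure μ] {z : ℂ} (hz : 0 < z.im) :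
    (cauchyG μ z).im < 0 := by
  rw [cauchyG_im μ hz]
  have := integral_norm_inv_sub_sq_pos μ hz
  have := mul_pos hz this
  linarith

lemma cauchyG_ne_zero (μ : Measure ℝ) [IsProbabilityMeasure μ] {z : ℂ} (hz : 0 < z.im) :
    cauchyG μ z ≠ 0 := by
  intro h
  have := cauchyG_im_neg μ hz
  simp [h] at this

lemma le_im_Ftr (μ : Measure ℝ) [IsProbabilityMeasure μ] {z : ℂ} (hz : 0 < z.im) :
    z.im ≤ (Ftr μ z).im := by
  have h0 : 0 < ‖cauchyG μ z‖ ^ 2 := by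
    have := norm_pos_iff.2 (cauchyG_ne_zero μ hz)
    positivity
  rw [Ftr, Complex.inv_im, Complex.normSq_eq_norm_sq, le_div_iff₀ h0, cauchyG_im μ hz, neg_neg]
  exact mul_le_mul_of_nonneg_left (norm_cauchyG_sq_le μ hz) hz.le

lemma Ftr_mem_UHP (μ : Measure ℝ) [IsProbabilityMeasure μ] {z : ℂ} (hz : z ∈ UHP) :
    Ftr μ z ∈ UHP :=
  lt_of_lt_of_le hz (le_im_Ftr μ hz)

lemma differentiableOn_Ftr (μ : Measure ℝ) [IsProbabilityMeasure μ] :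
    DifferentiableOn ℂ (Ftr μ) UHP :=
  (differentiableOn_cauchyG μ).inv fun _ hz => cauchyG_ne_zero μ hz

/-- The Cauchy transform is Lipschitz away from the real axis. -/
lemma norm_cauchyG_sub_le (μ : Measure ℝ) [IsProbabilityMeasure μ] {z w : ℂ} (hz : 0 < z.im)
    (hw : 0 < w.im) : ‖cauchyG μ z - cauchyG μ w‖ ≤ ‖z - w‖ * (z.im⁻¹ * w.im⁻¹) := by
  rw [cauchyG, cauchyG, ← integral_sub (integrable_inv_sub μ hz) (integrable_inv_sub μ hw)]
  have : ∀ x : ℝ, ‖(z - (x : ℂ))⁻¹ - (w - (x : ℂ))⁻¹‖ ≤ ‖z - w‖ * (z.im⁻¹ * w.im⁻¹) := by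
    intro x
    have h1 := sub_ofReal_ne_zero hz.ne' x
    have h2 := sub_ofReal_ne_zero hw.ne' x
    have : (z - (x : ℂ))⁻¹ - (w - (x : ℂ))⁻¹ = (w - z) * ((z - x)⁻¹ * (w - x)⁻¹) := by
      field_simp
      ring
    rw [this, norm_mul, norm_mul, norm_sub_rev]
    gcongr
    · exact norm_inv_sub_le hz x
    · exact norm_inv_sub_le hw x
  simpa using norm_integral_le_of_norm_le_const (μ := μ) (ae_of_all _ this)

lemma norm_inv_sub_sq (z : ℂ) (x : ℝ) :
    ‖(z - (x : ℂ))⁻¹‖ ^ 2 = ((x - z.re) ^ 2 + z.im ^ 2)⁻¹ := by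
  rw [norm_inv, inv_pow, ← Complex.normSq_eq_norm_sq, Complex.normSq_apply]
  congr 1
  simp
  ring

end CauchyTransform

section LimitMeasure

open Filter Topology

lemma measure_norm_gt_le (ν : Measure ℝ) [IsProbabilityMeasure ν] {y : ℝ} (hy : 0 < y) :
    ν {x | y < ‖x‖} ≤ ENNReal.ofReal (2 * (1 + y * (cauchyG ν (y * I)).im)) := by
  have hz : 0 < ((y : ℂ) * I).im := by simpa using hy
  have hint := (integrable_norm_inv_sub_sq ν hz).const_mul (y ^ 2)
  have heq : 1 + y * (cauchyG ν (y * I)).im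
      = ∫ x : ℝ, (1 - y ^ 2 * ‖(y * I - (x : ℂ))⁻¹‖ ^ 2) ∂ν := by
    rw [integral_sub (integrable_const _) hint, integral_const_mul, cauchyG_im ν hz]
    simp
    ring
  have hval : ∀ x : ℝ, 1 - y ^ 2 * ‖(y * I - (x : ℂ))⁻¹‖ ^ 2 = x ^ 2 / (x ^ 2 + y ^ 2) := by
    intro x
    have : x ^ 2 + y ^ 2 ≠ 0 := by positivity
    rw [norm_inv_sub_sq]
    simp
    field_simp
    ring
  have hnn : ∀ x : ℝ, 0 ≤ 1 - y ^ 2 * ‖(y * I - (x : ℂ))⁻¹‖ ^ 2 := fun x => by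
    rw [hval]; positivity
  have hM := mul_meas_ge_le_integral_of_nonneg (ae_of_all ν hnn)
    ((integrable_const 1).sub hint) (1 / 2)
  rw [← heq] at hM
  have hsub : ν.real {x | y < ‖x‖} ≤
      ν.real {x : ℝ | 1 / 2 ≤ 1 - y ^ 2 * ‖(y * I - (x : ℂ))⁻¹‖ ^ 2} := by
    apply measureReal_mono _ (measure_ne_top _ _)
    intro x hx
    have hx' : y < |x| := hx
    have : y ^ 2 ≤ x ^ 2 := by rw [← sq_abs x]; gcongr
    simp only [Set.mem_ofPred_eq, hval]
    rw [div_le_div_iff₀ (by norm_num) (by positivity)]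
    linarith
  rw [← ofReal_measureReal]
  apply ENNReal.ofReal_le_ofReal
  linarith

theorem exists_limit_measure (ν : ℕ → Measure ℝ) [hν : ∀ n, IsProbabilityMeasure (ν n)]
    (g : ℂ → ℂ) {K : ℝ} (hK : 0 ≤ K)
    (hlim : ∀ z : ℂ, K < z.im → Tendsto (fun n => cauchyG (ν n) z) atTop (𝓝 (g z)))
    (hg : Tendsto (fun y : ℝ => (y : ℂ) * I * g (y * I)) atTop (𝓝 1)) :
    ∃ ρ : Measure ℝ, IsProbabilityMeasure ρ ∧ ∀ z : ℂ, K < z.im → cauchyG ρ z = g z := by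
  have hre : Tendsto (fun y : ℝ => ENNReal.ofReal (2 * (1 + y * (g (y * I)).im))) atTop (𝓝 0) := by
    have h1 := (Complex.continuous_re.tendsto _).comp hg
    have h2 : Tendsto (fun y : ℝ => 2 * (1 + y * (g (y * I)).im)) atTop (𝓝 (2 * (1 - 1))) := by
      refine Tendsto.const_mul _ ((tendsto_const_nhds.sub h1).congr fun y => ?_)
      simp [Complex.mul_re]
    rw [← ENNReal.ofReal_zero]
    exact ENNReal.tendsto_ofReal (by simpa using h2)
  have htight : IsTightMeasureSet (Set.range ν) := by
    apply isTightMeasureSet_range_of_tendsto_limsup_measure_norm_gt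
    refine tendsto_of_tendsto_of_tendsto_of_le_of_le' tendsto_const_nhds hre
      (Eventually.of_forall fun _ => zero_le) ?_
    filter_upwards [eventually_gt_atTop K] with y hy
    have hy0 : 0 < y := lt_of_le_of_lt hK hy
    have h3 : Tendsto (fun n => ENNReal.ofReal (2 * (1 + y * (cauchyG (ν n) (y * I)).im))) atTop
        (𝓝 (ENNReal.ofReal (2 * (1 + y * (g (y * I)).im)))) := by
      apply ENNReal.tendsto_ofReal
      refine Tendsto.const_mul _ (tendsto_const_nhds.add (Tendsto.const_mul _ ?_))
      exact (Complex.continuous_im.tendsto _).comp (hlim _ (by simpa using hy))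
    calc limsup (fun n => ν n {x | y < ‖x‖}) atTop
        ≤ limsup (fun n => ENNReal.ofReal (2 * (1 + y * (cauchyG (ν n) (y * I)).im))) atTop :=
          limsup_le_limsup (Eventually.of_forall fun n => measure_norm_gt_le (ν n) hy0)
      _ = _ := h3.limsup_eq
  let P : ℕ → ProbabilityMeasure ℝ := fun n => ⟨ν n, hν n⟩
  have hcomp : IsCompact (closure (Set.range P)) := by
    apply isCompact_closure_of_isTightMeasureSet
    convert! htight using 1
    ext m
    constructor
    · rintro ⟨_, ⟨n, rfl⟩, rfl⟩
      exact ⟨n, rfl⟩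
    · rintro ⟨n, rfl⟩
      exact ⟨P n, ⟨n, rfl⟩, rfl⟩
  obtain ⟨ρ, -, φ, hφ, hρ⟩ := hcomp.tendsto_subseq fun n => subset_closure (Set.mem_range_self n)
  refine ⟨ρ, inferInstance, fun z hz => ?_⟩
  have hz0 : 0 < z.im := lt_of_le_of_lt hK hz
  rw [ProbabilityMeasure.tendsto_iff_forall_integral_rclike_tendsto ℂ] at hρ
  have h4 := hρ (BoundedContinuousFunction.ofNormedAddCommGroup
    (fun x : ℝ => (z - (x : ℂ))⁻¹) (continuous_inv_sub hz0.ne') z.im⁻¹ (norm_inv_sub_le hz0))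
  exact tendsto_nhds_unique h4 ((hlim z hz).comp hφ.tendsto_atTop)

end LimitMeasure

section HalfPlane

open Filter Topology ProbabilityTheory ComplexConjugate

lemma integral_poisson_kernel {z : ℂ} (hz : 0 < z.im) :
    Integrable (fun x : ℝ => ((x - z.re) ^ 2 + z.im ^ 2)⁻¹) ∧
    ∫ x : ℝ, ((x - z.re) ^ 2 + z.im ^ 2)⁻¹ = Real.pi * z.im⁻¹ := by
  obtain ⟨γ, hγ⟩ : ∃ γ : NNReal, (γ : ℝ) = z.im := ⟨⟨z.im, hz.le⟩, rfl⟩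
  have hγ0 : γ ≠ 0 := by
    rintro rfl
    simp [← hγ] at hz
  have hpdf : ∀ x, ((x - z.re) ^ 2 + z.im ^ 2)⁻¹
      = Real.pi * z.im⁻¹ * cauchyPDFReal z.re γ x := by
    intro x
    have := Real.pi_ne_zero
    simp only [cauchyPDFReal_def, hγ]
    field_simp
  simp_rw [hpdf]
  refine ⟨(integrable_cauchyPDFReal z.re).const_mul _, ?_⟩
  rw [integral_const_mul, integral_cauchyPDFReal_eq_one _ hγ0, mul_one]

lemma integral_poisson_eq_zero {g : ℂ → ℂ} {C : ℝ}
    (hd : ∀ z : ℂ, 0 ≤ z.im → DifferentiableAt ℂ g z) (hC : ∀ z : ℂ, 0 ≤ z.im → ‖g z‖ ≤ C)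
    {z : ℂ} (hz : 0 < z.im) :
    Integrable (fun x : ℝ => (((x - z.re) ^ 2 + z.im ^ 2)⁻¹ : ℝ) * (g x - g z)) ∧
    ∫ x : ℝ, (((x - z.re) ^ 2 + z.im ^ 2)⁻¹ : ℝ) * (g x - g z) = 0 := by
  have hker := (integral_poisson_kernel hz).1
  have hcont : Continuous fun x : ℝ => g x - g z := by
    refine Continuous.sub (continuous_iff_continuousAt.2 fun x => ?_) continuous_const
    exact (hd x (by simp)).continuousAt.comp Complex.continuous_ofReal.continuousAt
  have hC0 : 0 ≤ C := (norm_nonneg _).trans (hC z hz.le)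
  have hint : Integrable (fun x : ℝ => (((x - z.re) ^ 2 + z.im ^ 2)⁻¹ : ℝ) * (g x - g z)) := by
    refine Integrable.mul_bdd (c := C + C) hker.ofReal hcont.aestronglyMeasurable
      (ae_of_all _ fun x => ?_)
    exact (norm_sub_le _ _).trans (add_le_add (hC x (by simp)) (hC z hz.le))
  refine ⟨hint, ?_⟩
  let h : ℂ → ℂ := fun ζ => dslope g z ζ * (ζ - conj z)⁻¹
  have hval : ∀ ζ, ζ ≠ z → h ζ = (g ζ - g z) * ((ζ - z)⁻¹ * (ζ - conj z)⁻¹) := by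
    intro ζ hζ
    simp only [h, dslope_of_ne _ hζ, slope_def_field]
    ring
  have hbot : ∀ x : ℝ, h x = (((x - z.re) ^ 2 + z.im ^ 2)⁻¹ : ℝ) * (g x - g z) := by
    intro x
    have hx : (x : ℂ) ≠ z := by
      intro hx
      rw [← hx] at hz
      simp at hz
    rw [hval _ hx, ← mul_inv, mul_comm]
    congr 1
    push_cast
    congr 1
    (apply Complex.ext <;> simp [pow_two]); ring
  have hbd : ∀ T : ℝ, ‖z‖ < T → ∀ ζ : ℂ, T ≤ ‖ζ‖ → 0 ≤ ζ.im →
      ‖h ζ‖ ≤ (C + C) * ((T - ‖z‖)⁻¹ * (T - ‖z‖)⁻¹) := by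
    intro T hT ζ hζ him
    have h1 : T - ‖z‖ ≤ ‖ζ - z‖ := by linarith [norm_sub_norm_le ζ z]
    have h2 : T - ‖z‖ ≤ ‖ζ - conj z‖ := by
      have := norm_sub_norm_le ζ (conj z)
      rw [RCLike.norm_conj] at this
      linarith
    have h0 : 0 < T - ‖z‖ := by linarith
    have hne : ζ ≠ z := by
      rintro rfl
      linarith
    rw [hval _ hne, norm_mul, norm_mul, norm_inv, norm_inv]
    gcongr
    exact (norm_sub_le _ _).trans (add_le_add (hC ζ him) (hC z hz.le))
  have hmain : ∀ T : ℝ, ‖z‖ < T →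
      ‖∫ x in (-T)..T, h x‖ ≤ 4 * T * ((C + C) * ((T - ‖z‖)⁻¹ * (T - ‖z‖)⁻¹)) := by
    intro T hT
    set B := (C + C) * ((T - ‖z‖)⁻¹ * (T - ‖z‖)⁻¹) with hB
    have hT0 : 0 < T := (norm_nonneg z).trans_lt hT
    have hrz := (Complex.abs_re_le_norm z).trans_lt hT
    have hiz := (Complex.im_le_norm z).trans_lt hT
    rw [abs_lt] at hrz
    have hdiff : DifferentiableOn ℂ h (Set.uIcc (-T) T ×ℂ Set.uIcc 0 T) := by
      rw [Set.uIcc_of_le (by linarith), Set.uIcc_of_le hT0.le]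
      refine DifferentiableOn.mul ?_ ?_
      · rw [Complex.differentiableOn_dslope]
        · intro ζ hζ
          exact (hd ζ hζ.2.1).differentiableWithinAt
        · exact inter_mem
            (Complex.continuous_re.continuousAt.preimage_mem_nhds (Icc_mem_nhds hrz.1 hrz.2))
            (Complex.continuous_im.continuousAt.preimage_mem_nhds (Icc_mem_nhds hz hiz))
      · refine DifferentiableOn.inv (by fun_prop) fun ζ hζ h0 => ?_
        have h1 := congrArg Complex.im h0
        have h2 : 0 ≤ ζ.im := hζ.2.1
        simp at h1
        linarith
    have hrect := Complex.integral_boundary_rect_eq_zero_of_differentiableOn h ⟨-T, 0⟩ ⟨T, T⟩ hdiff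
    simp only [ofReal_zero, zero_mul, add_zero] at hrect
    have e1 : ‖∫ x in (-T)..T, h (x + T * I)‖ ≤ B * |T - -T| := by
      refine intervalIntegral.norm_integral_le_of_norm_le_const fun x hx => hbd T hT _ ?_ ?_
      · have := Complex.im_le_norm ((x : ℂ) + T * I)
        simpa using this
      · simpa using hT0.le
    have e2 : ‖∫ y in (0 : ℝ)..T, h ((T : ℂ) + y * I)‖ ≤ B * |T - 0| := by
      refine intervalIntegral.norm_integral_le_of_norm_le_const fun y hy => hbd T hT _ ?_ ?_
      · have := Complex.re_le_norm ((T : ℂ) + y * I)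
        simpa using this
      · rw [Set.uIoc_of_le hT0.le] at hy
        simpa using hy.1.le
    have e3 : ‖∫ y in (0 : ℝ)..T, h (((-T : ℝ) : ℂ) + y * I)‖ ≤ B * |T - 0| := by
      refine intervalIntegral.norm_integral_le_of_norm_le_const fun y hy => hbd T hT _ ?_ ?_
      · have := Complex.abs_re_le_norm (((-T : ℝ) : ℂ) + y * I)
        simpa [abs_of_pos hT0] using this
      · rw [Set.uIoc_of_le hT0.le] at hy
        simpa using hy.1.le
    have hsolve : ∫ x in (-T)..T, h x = (∫ x in (-T)..T, h (x + T * I))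
        - I • (∫ y in (0 : ℝ)..T, h ((T : ℂ) + y * I))
        + I • ∫ y in (0 : ℝ)..T, h (((-T : ℝ) : ℂ) + y * I) := by
      linear_combination hrect
    rw [abs_of_pos (by linarith)] at e1 e2 e3
    calc ‖∫ x in (-T)..T, h x‖ ≤ B * (T - -T) + B * (T - 0) + B * (T - 0) := by
          rw [hsolve]
          refine (norm_add_le _ _).trans (add_le_add ((norm_sub_le _ _).trans (add_le_add e1 ?_)) ?_)
          · simpa [norm_smul] using e2
          · simpa [norm_smul] using e3
      _ = 4 * T * B := by ring
  have hlim0 : Tendsto (fun T : ℝ => 4 * T * ((C + C) * ((T - ‖z‖)⁻¹ * (T - ‖z‖)⁻¹)))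
      atTop (𝓝 0) := by
    have a1 : Tendsto (fun T : ℝ => T - ‖z‖) atTop atTop := tendsto_atTop_add_const_right _ _ tendsto_id
    have a2 := tendsto_inv_atTop_zero.comp a1
    have a3 : Tendsto (fun T : ℝ => 4 * (C + C) * ((T - ‖z‖)⁻¹ + ‖z‖ * ((T - ‖z‖)⁻¹ * (T - ‖z‖)⁻¹)))
        atTop (𝓝 (4 * (C + C) * (0 + ‖z‖ * (0 * 0)))) :=
      (a2.add ((a2.mul a2).const_mul _)).const_mul _
    simp only [mul_zero, add_zero] at a3
    refine a3.congr' ?_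
    filter_upwards [eventually_gt_atTop ‖z‖] with T hT
    have : T - ‖z‖ ≠ 0 := by linarith
    field_simp
    ring
  have hlim1 : Tendsto (fun T : ℝ => ∫ x in (-T)..T, h x) atTop (𝓝 0) :=
    squeeze_zero_norm' (by filter_upwards [eventually_gt_atTop ‖z‖] using hmain) hlim0
  have hint' : Integrable (fun x : ℝ => h x) := by simpa only [hbot] using hint
  have hlim2 := intervalIntegral_tendsto_integral hint' tendsto_neg_atTop_atBot tendsto_id
  have := tendsto_nhds_unique hlim2 hlim1
  simpa only [hbot] using this

/-- Poisson formula for the upper half-plane, imaginary part. -/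
lemma integral_poisson_im {g : ℂ → ℂ} {C : ℝ}
    (hd : ∀ z : ℂ, 0 ≤ z.im → DifferentiableAt ℂ g z) (hC : ∀ z : ℂ, 0 ≤ z.im → ‖g z‖ ≤ C)
    {z : ℂ} (hz : 0 < z.im) :
    Integrable (fun x : ℝ => ((x - z.re) ^ 2 + z.im ^ 2)⁻¹ * (g x).im) ∧
    z.im * ∫ x : ℝ, ((x - z.re) ^ 2 + z.im ^ 2)⁻¹ * (g x).im = Real.pi * (g z).im := by
  obtain ⟨h1, h2⟩ := integral_poisson_eq_zero hd hC hz
  obtain ⟨hker, hkint⟩ := integral_poisson_kernel hz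
  have h3 : Integrable (fun x : ℝ => ((x - z.re) ^ 2 + z.im ^ 2)⁻¹ * ((g x).im - (g z).im)) := by
    refine h1.im.congr (ae_of_all _ fun x => ?_)
    simp only [RCLike.im_eq_complex_im, Complex.im_ofReal_mul, Complex.sub_im]
  have h4 : ∫ x : ℝ, ((x - z.re) ^ 2 + z.im ^ 2)⁻¹ * ((g x).im - (g z).im) = 0 := by
    have := integral_im h1
    simp only [RCLike.im_eq_complex_im, Complex.im_ofReal_mul, Complex.sub_im] at this
    rw [this, h2, Complex.zero_im]
  have h5 := hker.mul_const (g z).im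
  have heq : ∀ x : ℝ, ((x - z.re) ^ 2 + z.im ^ 2)⁻¹ * (g x).im
      = ((x - z.re) ^ 2 + z.im ^ 2)⁻¹ * ((g x).im - (g z).im)
        + ((x - z.re) ^ 2 + z.im ^ 2)⁻¹ * (g z).im := fun x => by ring
  simp_rw [heq]
  refine ⟨h3.add h5, ?_⟩
  rw [integral_add h3 h5, h4, integral_mul_const, hkint]
  field_simp
  ring

end HalfPlane

section Nevanlinna

open Filter Topology

lemma tendsto_zero_of_tendsto_mul_I {G : ℂ → ℂ} {c : ℂ}
    (h : Tendsto (fun y : ℝ => (y : ℂ) * I * G (y * I)) atTop (𝓝 c)) :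
    Tendsto (fun y : ℝ => G (y * I)) atTop (𝓝 0) := by
  have h1 : Tendsto (fun y : ℝ => ((y : ℂ) * I)⁻¹) atTop (𝓝 0) := by
    rw [tendsto_zero_iff_norm_tendsto_zero]
    refine tendsto_inv_atTop_zero.congr' ?_
    filter_upwards [eventually_gt_atTop 0] with y hy
    simp [abs_of_pos hy]
  have h2 := h1.mul h
  rw [zero_mul] at h2
  refine h2.congr' ?_
  filter_upwards [eventually_gt_atTop 0] with y hy
  have : (y : ℂ) ≠ 0 := by exact_mod_cast hy.ne'
  field_simp

lemma exists_measure_of_boundary {g : ℂ → ℂ} {C : ℝ}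
    (hd : ∀ z : ℂ, 0 ≤ z.im → DifferentiableAt ℂ g z) (hC : ∀ z : ℂ, 0 ≤ z.im → ‖g z‖ ≤ C)
    (him : ∀ z : ℂ, 0 ≤ z.im → (g z).im ≤ 0)
    (hg : Tendsto (fun y : ℝ => (y : ℂ) * I * g (y * I)) atTop (𝓝 1)) :
    ∃ ν : Measure ℝ, IsProbabilityMeasure ν ∧ ∀ z ∈ UHP, cauchyG ν z = g z := by
  have hpi := Real.pi_pos
  let f : ℝ → ℝ := fun x => -(g x).im / Real.pi
  have hf0 : ∀ x, 0 ≤ f x := fun x =>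
    div_nonneg (neg_nonneg.2 (him x (by simp))) hpi.le
  have hgc : Continuous fun x : ℝ => g x := continuous_iff_continuousAt.2 fun x =>
    (hd x (by simp)).continuousAt.comp Complex.continuous_ofReal.continuousAt
  have hfc : Continuous f := ((Complex.continuous_im.comp hgc).neg).div_const _
  have hfm : Measurable fun x => ENNReal.ofReal (f x) := hfc.measurable.ennreal_ofReal
  have hint : ∀ z : ℂ, 0 < z.im →
      Integrable (fun x : ℝ => ((x - z.re) ^ 2 + z.im ^ 2)⁻¹ * f x) ∧
      z.im * ∫ x : ℝ, ((x - z.re) ^ 2 + z.im ^ 2)⁻¹ * f x = -(g z).im := by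
    intro z hz
    obtain ⟨h1, h2⟩ := integral_poisson_im hd hC hz
    have heq : ∀ x : ℝ, ((x - z.re) ^ 2 + z.im ^ 2)⁻¹ * f x
        = -Real.pi⁻¹ * (((x - z.re) ^ 2 + z.im ^ 2)⁻¹ * (g x).im) := fun x => by
      simp only [f]; ring
    simp_rw [heq]
    refine ⟨h1.const_mul _, ?_⟩
    rw [integral_const_mul, mul_left_comm, h2]
    field_simp
  have hmass : ∫⁻ x, ENNReal.ofReal (f x) = 1 := by
    let F : ℕ → ℝ → ℝ := fun n x =>
      ((n : ℝ) + 1) ^ 2 * ((x ^ 2 + ((n : ℝ) + 1) ^ 2)⁻¹ * f x)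
    have hy : ∀ n : ℕ, 0 < (((n + 1 : ℝ) : ℂ) * I).im := fun n => by
      have : (0 : ℝ) < n + 1 := by positivity
      simpa using this
    have hlim := lintegral_tendsto_of_tendsto_of_monotone (μ := volume)
      (f := fun n x => ENNReal.ofReal (F n x)) (F := fun x => ENNReal.ofReal (f x)) ?_ ?_ ?_
    · have hF : ∀ n : ℕ, ∫⁻ x, ENNReal.ofReal (F n x)
          = ENNReal.ofReal ((((n + 1 : ℝ) : ℂ) * I * g (((n + 1 : ℝ) : ℂ) * I)).re) := by
        intro n
        obtain ⟨h1, h2⟩ := hint _ (hy n)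
        have hn : (0 : ℝ) < n + 1 := by positivity
        simp only [re_ofReal_mul, im_ofReal_mul, I_re, I_im, mul_zero, mul_one, sub_zero] at h1 h2
        rw [← ofReal_integral_eq_lintegral_ofReal (h1.const_mul _)
          (ae_of_all _ fun x => mul_nonneg (by positivity) (mul_nonneg (by positivity) (hf0 x))),
          integral_const_mul]
        congr 1
        rw [mul_assoc, re_ofReal_mul, I_mul_re, ← h2]
        ring
      simp_rw [hF] at hlim
      have h3 := (ENNReal.tendsto_ofReal ((Complex.continuous_re.tendsto _).comp hg)).comp
        (tendsto_atTop_add_const_right _ (1 : ℝ) tendsto_natCast_atTop_atTop)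
      simp only [one_re, ENNReal.ofReal_one] at h3
      exact tendsto_nhds_unique hlim h3
    · intro n
      refine Measurable.aemeasurable (Measurable.ennreal_ofReal ?_)
      have := hfc.measurable
      fun_prop
    · refine ae_of_all _ fun x m n hmn => ENNReal.ofReal_le_ofReal ?_
      have hmn' : (m : ℝ) + 1 ≤ n + 1 := by gcongr
      have hm0 : (0 : ℝ) < m + 1 := by positivity
      simp only [F, ← mul_assoc]
      refine mul_le_mul_of_nonneg_right ?_ (hf0 x)
      rw [← div_eq_mul_inv, ← div_eq_mul_inv, div_le_div_iff₀ (by positivity) (by positivity)]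
      have : ((m : ℝ) + 1) ^ 2 ≤ (n + 1) ^ 2 := by gcongr
      nlinarith [sq_nonneg x]
    · refine ae_of_all _ fun x => ENNReal.tendsto_ofReal ?_
      have h4 : Tendsto (fun n : ℕ => ((n : ℝ) + 1)) atTop atTop :=
        tendsto_atTop_add_const_right _ _ tendsto_natCast_atTop_atTop
      have h5 : Tendsto (fun n : ℕ => x ^ 2 * (((n : ℝ) + 1) ^ 2)⁻¹ + 1) atTop
          (𝓝 (x ^ 2 * 0 + 1)) :=
        (((tendsto_pow_atTop two_ne_zero).comp h4).inv_tendsto_atTop.const_mul _).add_const _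
      have h6 := (h5.inv₀ (by simp)).mul_const (f x)
      simp only [mul_zero, zero_add, inv_one, one_mul] at h6
      refine h6.congr fun n => ?_
      have hn : ((n : ℝ) + 1) ≠ 0 := by positivity
      simp only [F]
      rw [← mul_assoc]
      congr 1
      field_simp
  let ν : Measure ℝ := volume.withDensity fun x => ENNReal.ofReal (f x)
  have hν : IsProbabilityMeasure ν := ⟨by
    rw [withDensity_apply _ MeasurableSet.univ, setLIntegral_univ, hmass]⟩
  refine ⟨ν, hν, ?_⟩
  have him_eq : ∀ z ∈ UHP, (cauchyG ν z - g z).im = 0 := by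
    intro z hz
    have hz : 0 < z.im := hz
    rw [sub_im, cauchyG_im ν hz, integral_withDensity_eq_integral_toReal_smul hfm
      (ae_of_all _ fun x => ENNReal.ofReal_lt_top)]
    have : ∀ x : ℝ, (ENNReal.ofReal (f x)).toReal • ‖(z - (x : ℂ))⁻¹‖ ^ 2
        = ((x - z.re) ^ 2 + z.im ^ 2)⁻¹ * f x := fun x => by
      rw [ENNReal.toReal_ofReal (hf0 x), norm_inv_sub_sq, smul_eq_mul, mul_comm]
    simp_rw [this]
    rw [(hint z hz).2]
    ring
  have hana : AnalyticOnNhd ℂ (fun z => cauchyG ν z - g z) UHP :=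
    DifferentiableOn.analyticOnNhd ((differentiableOn_cauchyG ν).sub fun z hz =>
      (hd z (le_of_lt hz)).differentiableWithinAt) isOpen_UHP
  obtain ⟨c, hc⟩ := hana.eq_const_of_im_eq_const him_eq isOpen_UHP
    ⟨⟨I, by simp [UHP]⟩, isPreconnected_UHP⟩
  have hc0 : c = 0 := by
    have h1 : Tendsto (fun y : ℝ => cauchyG ν (y * I)) atTop (𝓝 0) := by
      refine squeeze_zero_norm' ?_ tendsto_inv_atTop_zero
      filter_upwards [eventually_gt_atTop 0] with y hy
      have hy' : 0 < ((y : ℂ) * I).im := by simpa using hy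
      simpa using norm_cauchyG_le ν hy'
    have h2 := h1.sub (tendsto_zero_of_tendsto_mul_I hg)
    rw [sub_zero] at h2
    refine tendsto_nhds_unique (tendsto_const_nhds.congr' ?_) h2
    filter_upwards [eventually_gt_atTop 0] with y hy
    exact (hc _ (show 0 < ((y : ℂ) * I).im by simpa using hy)).symm
  intro z hz
  have := hc z hz
  rw [hc0] at this
  exact sub_eq_zero.1 this

/-- Characterization of Cauchy transforms of probability measures. -/
theorem exists_cauchyG_eq {G : ℂ → ℂ} (hd : DifferentiableOn ℂ G UHP)
    (him : ∀ z ∈ UHP, (G z).im ≤ 0) {R C : ℝ} (hC : ∀ z ∈ UHP, R ≤ ‖z‖ → ‖G z‖ ≤ C)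
    (hG : Tendsto (fun y : ℝ => (y : ℂ) * I * G (y * I)) atTop (𝓝 1)) :
    ∃ ν : Measure ℝ, IsProbabilityMeasure ν ∧ ∀ z ∈ UHP, cauchyG ν z = G z := by
  have hdat : ∀ z ∈ UHP, DifferentiableAt ℂ G z := fun z hz =>
    hd.differentiableAt (isOpen_UHP.mem_nhds hz)
  have key : ∀ ε : ℝ, 0 < ε → ∃ ν : Measure ℝ, IsProbabilityMeasure ν ∧
      ∀ z ∈ UHP, cauchyG ν z = G (z + ε * I) := by
    intro ε hε
    have hmem : ∀ z : ℂ, 0 ≤ z.im → z + ε * I ∈ UHP := fun z hz => by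
      change 0 < (z + ε * I).im
      simp
      linarith
    have hd' : ∀ z : ℂ, 0 ≤ z.im → DifferentiableAt ℂ (fun z => G (z + ε * I)) z := fun z hz =>
      (hdat _ (hmem z hz)).comp z (by fun_prop)
    have hcpt : IsCompact (Metric.closedBall (0 : ℂ) (R + ε) ∩ {z : ℂ | 0 ≤ z.im}) :=
      (isCompact_closedBall _ _).inter_right (isClosed_le continuous_const Complex.continuous_im)
    obtain ⟨C', hC'⟩ := hcpt.exists_bound_of_continuousOn (f := fun z => G (z + ε * I))
      fun z hz => (hd' z hz.2).continuousAt.continuousWithinAt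
    have hbd : ∀ z : ℂ, 0 ≤ z.im → ‖G (z + ε * I)‖ ≤ max C C' := by
      intro z hz
      by_cases h : ‖z‖ ≤ R + ε
      · exact (hC' z ⟨by simpa using h, hz⟩).trans (le_max_right _ _)
      · refine (hC _ (hmem z hz) ?_).trans (le_max_left _ _)
        have := norm_sub_le (z + ε * I) (ε * I)
        simp [abs_of_pos hε] at this
        linarith
    refine exists_measure_of_boundary hd' hbd (fun z hz => him _ (hmem z hz)) ?_
    have h1 := hG.comp (tendsto_atTop_add_const_right _ ε tendsto_id)
    have h2 : Tendsto (fun y : ℝ => ((1 - ε * (y + ε)⁻¹ : ℝ) : ℂ)) atTop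
        (𝓝 ((1 - ε * 0 : ℝ) : ℂ)) := by
      refine (Complex.continuous_ofReal.tendsto _).comp ?_
      exact tendsto_const_nhds.sub ((tendsto_inv_atTop_zero.comp
        (tendsto_atTop_add_const_right _ ε tendsto_id)).const_mul _)
    have h3 := h2.mul h1
    simp only [mul_zero, sub_zero, ofReal_one, one_mul] at h3
    refine h3.congr' ?_
    filter_upwards [eventually_gt_atTop 0] with y hy
    have hne : ((y : ℂ) + ε) ≠ 0 := by exact_mod_cast (by positivity : y + ε ≠ 0)
    simp only [Function.comp_apply, id]
    push_cast
    rw [add_mul]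
    field_simp
    ring
  choose! ν hν hνG using fun n : ℕ => key (1 / ((n : ℝ) + 1)) Nat.one_div_pos_of_nat
  refine exists_limit_measure ν G le_rfl (fun z hz => ?_) hG
  simp_rw [hνG _ z hz]
  refine ((hdat z hz).continuousAt.tendsto).comp ?_
  have h1 : Tendsto (fun n : ℕ => z + ((1 / ((n : ℝ) + 1) : ℝ) : ℂ) * I) atTop
      (𝓝 (z + ((0 : ℝ) : ℂ) * I)) :=
    tendsto_const_nhds.add (((Complex.continuous_ofReal.tendsto _).comp
      tendsto_one_div_add_atTop_nhds_zero_nat).mul_const _)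
  simpa using h1

end Nevanlinna

section Superconvergence

open Filter Topology ComplexConjugate

/-- A complex mean value theorem on a convex set, with separate intermediate points for the real
and the imaginary part. -/
lemma exists_deriv_slope {A : ℂ → ℂ} {s : Set ℂ} (hs : Convex ℝ s)
    (hd : ∀ u ∈ s, DifferentiableAt ℂ A u) {v w : ℂ} (hv : v ∈ s) (hw : w ∈ s) :
    ∃ ξ ∈ segment ℝ w v, ∃ ζ ∈ segment ℝ w v,
      A v - A w = (v - w) * ((deriv A ξ).re + (deriv A ζ).im * I) := by
  by_cases hvw : v = w
  · subst hvw
    exact ⟨v, left_mem_segment ℝ v v, v, left_mem_segment ℝ v v, by simp⟩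
  have hne : v - w ≠ 0 := sub_ne_zero.2 hvw
  have hseg : ∀ t ∈ Set.Icc (0 : ℝ) 1, w + t * (v - w) ∈ segment ℝ w v := by
    intro t ht
    rw [segment_eq_image']
    exact ⟨t, ht, by simp⟩
  have hder : ∀ t ∈ Set.Icc (0 : ℝ) 1,
      HasDerivAt (fun t : ℝ => A (w + t * (v - w)) / (v - w)) (deriv A (w + t * (v - w))) t := by
    intro t ht
    have h1 : HasDerivAt (fun t : ℝ => w + (t : ℂ) * (v - w)) (v - w) t := by
      simpa using ((Complex.ofRealCLM.hasDerivAt (x := t)).mul_const (v - w)).const_add w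
    have h2 := (hd _ (hs.segment_subset hw hv (hseg t ht))).hasDerivAt
    have h3 := (h2.scomp t h1).div_const (v - w)
    simpa [smul_eq_mul, mul_div_assoc, hne, mul_div_cancel_left₀] using h3
  have hre := fun t ht => (Complex.reCLM.hasFDerivAt.comp_hasDerivAt t (hder t ht))
  have him := fun t ht => (Complex.imCLM.hasFDerivAt.comp_hasDerivAt t (hder t ht))
  obtain ⟨a, ha, ha'⟩ := exists_hasDerivAt_eq_slope _ _ zero_lt_one
    (fun t ht => (hre t ht).continuousAt.continuousWithinAt)
    (fun t ht => hre t (Set.Ioo_subset_Icc_self ht))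
  obtain ⟨b, hb, hb'⟩ := exists_hasDerivAt_eq_slope _ _ zero_lt_one
    (fun t ht => (him t ht).continuousAt.continuousWithinAt)
    (fun t ht => him t (Set.Ioo_subset_Icc_self ht))
  refine ⟨_, hseg a (Set.Ioo_subset_Icc_self ha), _, hseg b (Set.Ioo_subset_Icc_self hb), ?_⟩
  have hcomb : (A v - A w) / (v - w)
      = (deriv A (w + a * (v - w))).re + (deriv A (w + b * (v - w))).im * I := by
    apply Complex.ext
    · have : ((A v - A w) / (v - w)).re = (deriv A (w + a * (v - w))).re := by
        simpa [sub_div] using ha'.symm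
      simp [this]
    · have : ((A v - A w) / (v - w)).im = (deriv A (w + b * (v - w))).im := by
        simpa [sub_div] using hb'.symm
      simp [this]
  rw [← hcomb, mul_div_cancel₀ _ hne]

lemma mul_mul_ne_one_of_im_neg {a b β : ℂ} (ha : a.im < 0) (hb : b.im < 0)
    (hna : ‖a‖ ^ 2 ≤ 10 / 9) (hnb : ‖b‖ ^ 2 ≤ 10 / 9) (hre : |β.re - 1| ≤ 1 / 10)
    (him : |β.im| ≤ (|a.im| + |b.im|) / 20) : a * b * β ≠ 1 := by
  intro h
  rw [← Complex.normSq_eq_norm_sq, Complex.normSq_apply] at hna hnb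
  have h1 := congrArg Complex.re h
  have h2 := congrArg Complex.im h
  obtain ⟨a1, a2⟩ := a
  obtain ⟨b1, b2⟩ := b
  obtain ⟨x, y⟩ := β
  simp only [mul_re, mul_im, one_re, one_im] at *
  rw [abs_of_neg ha, abs_of_neg hb] at him
  rw [abs_le] at hre him
  have hx1 : 9 / 10 ≤ x := by linarith
  have hx2 : x ≤ 11 / 10 := by linarith
  set P := a1 * b1 - a2 * b2 with hP
  set Q := a1 * b2 + a2 * b1 with hQ
  have hP0 : P * (x ^ 2 + y ^ 2) = x := by linear_combination x * h1 + y * h2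
  have hQ0 : Q * (x ^ 2 + y ^ 2) = -y := by linear_combination x * h2 - y * h1
  have ha2 : -a2 ≤ 11 / 10 := by nlinarith [mul_self_nonneg a1]
  have hb2 : -b2 ≤ 11 / 10 := by nlinarith [mul_self_nonneg b1]
  have hy2 : y ^ 2 ≤ 1 / 50 := by nlinarith
  obtain ⟨S, hS⟩ : ∃ S, S = x ^ 2 + y ^ 2 := ⟨_, rfl⟩
  rw [← hS] at hP0 hQ0
  have hSu : S ≤ 5 / 4 := by nlinarith
  have hSl : 81 / 100 ≤ S := by nlinarith
  have hPl : 7 / 10 ≤ P := by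
    by_contra! hc
    linarith [mul_pos (sub_pos.2 hc) (by linarith : 0 < S)]
  have hab : 7 / 10 ≤ a1 * b1 := by linarith [mul_pos_of_neg_of_neg ha hb]
  have hTS := mul_nonneg (by linarith : 0 ≤ -a2 + -b2) (sub_nonneg.2 hSl)
  have hQ1 : Q ≤ (-a2 + -b2) / 10 := by
    by_contra! hc
    linarith [mul_pos (sub_pos.2 hc) (by linarith : 0 < S)]
  have hQ2 : -((-a2 + -b2) / 10) ≤ Q := by
    by_contra! hc
    linarith [mul_pos (sub_pos.2 hc) (by linarith : 0 < S)]
  have ha1 : |a1| ≤ 11 / 10 := abs_le_of_sq_le_sq (by nlinarith [mul_self_nonneg a2]) (by norm_num)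
  have hb1 : |b1| ≤ 11 / 10 := abs_le_of_sq_le_sq (by nlinarith [mul_self_nonneg b2]) (by norm_num)
  rw [abs_le] at ha1 hb1
  rcases le_or_gt a1 0 with h0 | h0
  · have e1 : a1 ≤ -1 / 2 := by
      linarith [mul_nonneg (neg_nonneg.2 h0) (by linarith : 0 ≤ b1 + 11 / 10)]
    have e2 : b1 ≤ -1 / 2 := by
      by_contra! hc
      linarith [mul_pos (sub_pos.2 hc) (by linarith : 0 < -a1)]
    linarith [mul_nonneg (sub_nonneg.2 e1) (by linarith : 0 ≤ -b2),
      mul_nonneg (sub_nonneg.2 e2) (by linarith : 0 ≤ -a2)]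
  · have e1 : 1 / 2 ≤ a1 := by
      linarith [mul_nonneg h0.le (by linarith : 0 ≤ 11 / 10 - b1)]
    have e2 : 1 / 2 ≤ b1 := by
      by_contra! hc
      linarith [mul_pos (sub_pos.2 hc) h0]
    linarith [mul_nonneg (sub_nonneg.2 e1) (by linarith : 0 ≤ -b2),
      mul_nonneg (sub_nonneg.2 e2) (by linarith : 0 ≤ -a2)]

end Superconvergence

section NormalizedInverse

open Filter Topology ComplexConjugate

/-- A function on the disc of radius `3` which is real on the real axis and whose derivative is
close to `1`. -/
structure NearIdentity (A : ℂ → ℂ) : Prop where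
  diff : ∀ u : ℂ, ‖u‖ < 3 → DifferentiableAt ℂ A u
  conj_symm : ∀ u : ℂ, ‖u‖ < 3 → A (conj u) = conj (A u)
  re_deriv : ∀ u : ℂ, ‖u‖ < 3 → |(deriv A u).re - 1| ≤ 1 / 10
  im_deriv : ∀ u : ℂ, ‖u‖ < 3 → |(deriv A u).im| ≤ |u.im| / 20
  bounded : ∃ M : ℝ, ∀ u : ℂ, ‖u‖ < 3 → ‖A u‖ ≤ M

/-- The part of the disc of radius `2` in the lower half-plane that `v ↦ 1/v + A(v)` maps to the
upper half-plane. -/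
def inverseDomain (A : ℂ → ℂ) : Set ℂ := {v : ℂ | v.im < 0 ∧ ‖v‖ < 2 ∧ 0 < (v⁻¹ + A v).im}

variable {A : ℂ → ℂ}

lemma inv_im_eq (v : ℂ) : (v⁻¹).im = -v.im / ‖v‖ ^ 2 := by
  rw [Complex.inv_im, Complex.normSq_eq_norm_sq]

lemma NearIdentity.norm_sq_le (hA : NearIdentity A) {v : ℂ} (him : v.im < 0) (hv : ‖v‖ < 3)
    (hH : 0 < (v⁻¹ + A v).im) : ‖v‖ ^ 2 ≤ 10 / 9 := by
  have hcv : ‖conj v‖ < 3 := by rwa [RCLike.norm_conj]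
  obtain ⟨ξ, hξ, ζ, -, h⟩ := exists_deriv_slope (convex_ball (0 : ℂ) 3)
    (fun u hu => hA.diff u (by simpa using hu)) (v := v) (w := conj v) (by simpa using hv)
    (by simpa using hcv)
  have hξ3 : ‖ξ‖ < 3 := by
    simpa using (convex_ball (0 : ℂ) 3).segment_subset (by simpa using hcv) (by simpa using hv) hξ
  have hre := (abs_le.1 (hA.re_deriv ξ hξ3)).1
  rw [hA.conj_symm v hv] at h
  have h1 := congrArg Complex.im h
  simp at h1
  have h2 : (A v).im = v.im * (deriv A ξ).re := by linarith
  have hn : 0 < ‖v‖ ^ 2 := by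
    have : v ≠ 0 := by rintro rfl; simp at him
    positivity
  rw [add_im, inv_im_eq, h2] at hH
  have h3 : 0 < -v.im * (1 - (deriv A ξ).re * ‖v‖ ^ 2) := by
    have h5 := mul_pos hH hn
    rw [add_mul, div_mul_cancel₀ _ hn.ne'] at h5
    linarith
  have h4 : 0 < 1 - (deriv A ξ).re * ‖v‖ ^ 2 := (pos_iff_pos_of_mul_pos h3).1 (by linarith)
  nlinarith

lemma NearIdentity.mul_mul_slope_ne_one (hA : NearIdentity A) {v w ξ ζ : ℂ}
    (hv : v ∈ inverseDomain A) (hw : w ∈ inverseDomain A)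
    (hξ : ξ ∈ segment ℝ w v) (hζ : ζ ∈ segment ℝ w v) :
    v * w * ((deriv A ξ).re + (deriv A ζ).im * I) ≠ 1 := by
  have hseg : segment ℝ w v ⊆ Metric.ball (0 : ℂ) 3 :=
    (convex_ball (0 : ℂ) 3).segment_subset (by simpa using hw.2.1.trans (by norm_num))
      (by simpa using hv.2.1.trans (by norm_num))
  have hξ3 : ‖ξ‖ < 3 := by simpa using hseg hξ
  have hζ3 : ‖ζ‖ < 3 := by simpa using hseg hζ
  refine mul_mul_ne_one_of_im_neg hv.1 hw.1
    (hA.norm_sq_le hv.1 (hv.2.1.trans (by norm_num)) hv.2.2)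
    (hA.norm_sq_le hw.1 (hw.2.1.trans (by norm_num)) hw.2.2) ?_ ?_
  · simpa using hA.re_deriv ξ hξ3
  · have h1 := hA.im_deriv ζ hζ3
    have h2 : |ζ.im| ≤ |v.im| + |w.im| := by
      obtain ⟨a, b, ha, hb, hab, rfl⟩ := hζ
      have e : (a • w + b • v).im = a * w.im + b * v.im := by simp
      rw [e]
      refine (abs_add_le _ _).trans ?_
      rw [abs_mul, abs_mul, abs_of_nonneg ha, abs_of_nonneg hb]
      nlinarith [abs_nonneg v.im, abs_nonneg w.im]
    simp
    linarith

lemma NearIdentity.injOn (hA : NearIdentity A) :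
    Set.InjOn (fun v => v⁻¹ + A v) (inverseDomain A) := by
  intro v hv w hw h
  simp only at h
  have hv0 : v ≠ 0 := by rintro rfl; simpa using hv.1
  have hw0 : w ≠ 0 := by rintro rfl; simpa using hw.1
  obtain ⟨ξ, hξ, ζ, hζ, hs⟩ := exists_deriv_slope (convex_ball (0 : ℂ) 3)
    (fun u hu => hA.diff u (by simpa using hu)) (v := v) (w := w)
    (by simpa using hv.2.1.trans (by norm_num)) (by simpa using hw.2.1.trans (by norm_num))
  have hne := hA.mul_mul_slope_ne_one hv hw hξ hζ
  by_contra hvw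
  apply hne
  have h0 := sub_ne_zero.2 hvw
  have h1 : A v - A w = w⁻¹ - v⁻¹ := by linear_combination h
  rw [h1] at hs
  apply mul_left_cancel₀ h0
  have h2 : v * w * (w⁻¹ - v⁻¹) = v - w := by field_simp
  linear_combination h2 - v * w * hs

lemma NearIdentity.isOpen_inverseDomain (hA : NearIdentity A) : IsOpen (inverseDomain A) := by
  rw [isOpen_iff_mem_nhds]
  intro v hv
  have hv0 : v ≠ 0 := by rintro rfl; simpa using hv.1
  have hc : ContinuousAt (fun v => v⁻¹ + A v) v :=
    (continuousAt_inv₀ hv0).add (hA.diff v (hv.2.1.trans (by norm_num))).continuousAt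
  filter_upwards [Complex.continuous_im.continuousAt.eventually_lt continuousAt_const hv.1,
    continuous_norm.continuousAt.eventually_lt continuousAt_const hv.2.1,
    continuousAt_const.eventually_lt (Complex.continuous_im.continuousAt.comp hc) hv.2.2]
    with x h1 h2 h3 using ⟨h1, h2, h3⟩

lemma NearIdentity.hasStrictDerivAt (hA : NearIdentity A) {v : ℂ} (hv : v ∈ inverseDomain A) :
    ∃ d : ℂ, d ≠ 0 ∧ HasStrictDerivAt (fun v => v⁻¹ + A v) d v := by
  have hv0 : v ≠ 0 := by rintro rfl; simpa using hv.1
  refine ⟨-(v ^ 2)⁻¹ + deriv A v, ?_, ?_⟩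
  · intro h
    have := hA.mul_mul_slope_ne_one hv hv (left_mem_segment ℝ v v) (left_mem_segment ℝ v v)
    rw [Complex.re_add_im] at this
    apply this
    have h1 : deriv A v = (v ^ 2)⁻¹ := by linear_combination h
    rw [h1]
    field_simp
  · have h1 : AnalyticAt ℂ A v := by
      rw [analyticAt_iff_eventually_differentiableAt]
      filter_upwards [continuous_norm.continuousAt.eventually_lt continuousAt_const
        (hv.2.1.trans (by norm_num : (2 : ℝ) < 3))] with u hu using hA.diff u hu
    exact (hasStrictDerivAt_inv hv0).add h1.hasStrictDerivAt

lemma NearIdentity.surjOn (hA : NearIdentity A) :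
    Set.SurjOn (fun v => v⁻¹ + A v) (inverseDomain A) UHP := by
  obtain ⟨M, hM⟩ := hA.bounded
  have hM0 : 0 ≤ M := (norm_nonneg _).trans (hM 0 (by simp))
  apply isPreconnected_UHP.subset_of_closure_inter_subset
  · rw [isOpen_iff_mem_nhds]
    rintro _ ⟨v, hv, rfl⟩
    obtain ⟨d, hd, h⟩ := hA.hasStrictDerivAt hv
    rw [← h.map_nhds_eq hd]
    exact image_mem_map (hA.isOpen_inverseDomain.mem_nhds hv)
  · let τ : ℝ := (M + 1)⁻¹
    have hτ : 0 < τ := by positivity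
    have hτ1 : τ ≤ 1 := inv_le_one_of_one_le₀ (by linarith)
    have hn : ‖-(τ * I)‖ = τ := by simp [abs_of_pos hτ]
    have him : 0 < ((-(τ * I) : ℂ)⁻¹ + A (-(τ * I))).im := by
      have h1 := hM (-(τ * I)) (by rw [hn]; linarith)
      have h2 := (abs_le.1 ((Complex.abs_im_le_norm _).trans h1)).1
      rw [add_im, inv_im_eq, hn]
      have : -(-(τ * I) : ℂ).im / τ ^ 2 = M + 1 := by
        simp only [neg_im, neg_neg, im_ofReal_mul, I_im, mul_one, τ]
        field_simp
      linarith
    exact ⟨_, him, -(τ * I), ⟨by simpa using hτ, by rw [hn]; linarith, him⟩, rfl⟩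
  · rintro z ⟨hz, hzU⟩
    obtain ⟨x, hx, hxz⟩ := mem_closure_iff_seq_limit.1 hz
    choose v hv hvx using hx
    simp only at hvx
    obtain ⟨w, hw, φ, hφ, hlim⟩ := (isCompact_closedBall (0 : ℂ) 2).tendsto_subseq
      (x := v) fun n => by simpa using (hv n).2.1.le
    have hw2 : ‖w‖ ≤ 2 := by simpa using hw
    have hxz' := hxz.comp hφ.tendsto_atTop
    have hw0 : w ≠ 0 := by
      rintro rfl
      have h1 : ∀ n, 1 ≤ ‖v n‖ * (‖x n‖ + M) := by
        intro n
        have hv0 : v n ≠ 0 := by intro h; simpa [h] using (hv n).1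
        have h2 : (v n)⁻¹ = x n - A (v n) := by rw [← hvx n]; ring
        have h3 : ‖(v n)⁻¹‖ ≤ ‖x n‖ + M := by
          rw [h2]
          exact (norm_sub_le _ _).trans (by gcongr; exact hM _ ((hv n).2.1.trans (by norm_num)))
        rw [norm_inv] at h3
        rwa [inv_le_iff_one_le_mul₀' (norm_pos_iff.2 hv0)] at h3
      have h2 : Tendsto (fun n => ‖v (φ n)‖ * (‖x (φ n)‖ + M)) atTop
          (𝓝 (‖(0 : ℂ)‖ * (‖z‖ + M))) := hlim.norm.mul (hxz'.norm.add_const M)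
      have h3 := ge_of_tendsto' h2 fun n => h1 (φ n)
      simp at h3
      linarith
    have hw3 : ‖w‖ < 3 := by linarith
    have hcont : ContinuousAt (fun v => v⁻¹ + A v) w :=
      (continuousAt_inv₀ hw0).add (hA.diff w hw3).continuousAt
    have hHw : w⁻¹ + A w = z := by
      refine tendsto_nhds_unique (hcont.tendsto.comp hlim) ?_
      simpa only [Function.comp_def, hvx] using hxz'
    have hz0 : 0 < (w⁻¹ + A w).im := by rw [hHw]; exact hzU
    have him : w.im < 0 := by
      have h1 : w.im ≤ 0 := le_of_tendsto' ((Complex.continuous_im.tendsto w).comp hlim)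
        fun n => (hv (φ n)).1.le
      refine lt_of_le_of_ne h1 fun h2 => ?_
      have h3 : conj w = w := Complex.conj_eq_iff_im.2 h2
      have h4 := hA.conj_symm w hw3
      rw [h3] at h4
      rw [add_im, inv_im_eq, h2, Complex.conj_eq_iff_im.1 h4.symm] at hz0
      simp at hz0
    refine ⟨w, ⟨him, ?_, hz0⟩, hHw⟩
    have := hA.norm_sq_le him hw3 hz0
    nlinarith [norm_nonneg w]

theorem NearIdentity.exists_measure (hA : NearIdentity A) :
    ∃ ω : Measure ℝ, IsProbabilityMeasure ω ∧
      ∀ z ∈ UHP, ‖cauchyG ω z‖ < 2 ∧ (cauchyG ω z)⁻¹ + A (cauchyG ω z) = z := by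
  choose! V hV hVz using fun z (hz : z ∈ UHP) => hA.surjOn hz
  simp only at hVz
  obtain ⟨M, hM⟩ := hA.bounded
  have hM' : ∀ z ∈ UHP, ‖A (V z)‖ ≤ M := fun z hz => hM _ ((hV _ hz).2.1.trans (by norm_num))
  have hV0 : ∀ z ∈ UHP, V z ≠ 0 := by
    intro z hz h
    simpa [h] using (hV _ hz).1
  have hdiff : DifferentiableOn ℂ V UHP := by
    intro z hz
    obtain ⟨d, hd, h⟩ := hA.hasStrictDerivAt (hV _ hz)
    have h1 := h.to_localInverse hd
    have h2 := h.eventually_right_inverse hd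
    have h3 : ContinuousAt (h.localInverse _ _ _ hd) (_) := h1.hasDerivAt.continuousAt
    have h4 : h.localInverse _ _ _ hd ((V z)⁻¹ + A (V z)) = V z :=
      HasStrictFDerivAt.localInverse_apply_image ..
    have h5 : inverseDomain A ∈ 𝓝 (h.localInverse _ _ _ hd ((V z)⁻¹ + A (V z))) := by
      rw [h4]
      exact hA.isOpen_inverseDomain.mem_nhds (hV _ hz)
    have h6 := h3.preimage_mem_nhds h5
    rw [hVz _ hz] at h1 h2 h6
    have h7 : V =ᶠ[𝓝 z] h.localInverse _ _ _ hd := by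
      filter_upwards [h2, h6, isOpen_UHP.mem_nhds hz] with y hy1 hy2 hy3
      exact hA.injOn (hV _ hy3) hy2 ((hVz _ hy3).trans hy1.symm)
    exact (h1.hasDerivAt.congr_of_eventuallyEq h7).differentiableAt.differentiableWithinAt
  have hbound : ∀ z ∈ UHP, ‖V z‖ * (‖z‖ - M) ≤ 1 := by
    intro z hz
    have h1 : 1 = V z * (z - A (V z)) := by
      nth_rewrite 2 [← hVz _ hz]
      field_simp [hV0 z hz]
      ring
    have h2 := congrArg norm h1
    rw [norm_one, norm_mul] at h2
    rw [h2]
    gcongr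
    linarith [norm_sub_norm_le z (A (V z)), hM' z hz]
  obtain ⟨ω, hω, hG⟩ := exists_cauchyG_eq (R := 0) (C := 2) hdiff (fun z hz => (hV _ hz).1.le)
    (fun z hz _ => (hV _ hz).2.1.le) (by
      rw [tendsto_iff_norm_sub_tendsto_zero]
      have h0 : Tendsto (fun y : ℝ => (y - M)⁻¹ * M) atTop (𝓝 (0 * M)) :=
        (tendsto_inv_atTop_zero.comp
          (tendsto_atTop_add_const_right _ (-M) tendsto_id)).mul_const M
      rw [zero_mul] at h0
      refine squeeze_zero' (Eventually.of_forall fun _ => norm_nonneg _) ?_ h0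
      filter_upwards [eventually_gt_atTop 0, eventually_gt_atTop M] with y hy hyM
      have hU : (y : ℂ) * I ∈ UHP := by simpa [UHP] using hy
      have h1 : (y : ℂ) * I * V (y * I) - 1 = V (y * I) * A (V (y * I)) := by
        nth_rewrite 1 [← hVz _ hU]
        field_simp [hV0 _ hU]
        ring
      rw [h1, norm_mul]
      have h2 := hbound _ hU
      simp only [norm_mul, norm_real, Real.norm_eq_abs, abs_of_pos hy, norm_I, mul_one] at h2
      gcongr
      · rwa [← one_div, le_div_iff₀ (by linarith)]
      · exact hM' _ hU)
  exact ⟨ω, hω, fun z hz => by rw [hG z hz]; exact ⟨(hV _ hz).2.1, hVz _ hz⟩⟩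

end NormalizedInverse

section Dilation

open Filter Topology ComplexConjugate

lemma exists_cauchyG_dilation (ω : Measure ℝ) [IsProbabilityMeasure ω] {η : ℝ} (hη : 0 < η) :
    ∃ ν : Measure ℝ, IsProbabilityMeasure ν ∧
      ∀ z : ℂ, 0 < z.im → cauchyG ν z = η * cauchyG ω (η * z) := by
  refine ⟨ω.map fun x => η⁻¹ * x, Measure.isProbabilityMeasure_map (by fun_prop), fun z hz => ?_⟩
  have hη' : (η : ℂ) ≠ 0 := by exact_mod_cast hη.ne'
  rw [cauchyG, integral_map (by fun_prop) (continuous_inv_sub hz.ne').aestronglyMeasurable,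
    cauchyG, ← integral_const_mul]
  congr 1
  ext x
  rw [← inv_inj, mul_inv, inv_inv, inv_inv]
  push_cast
  field_simp

lemma deriv_conj_symm {A : ℂ → ℂ} {r : ℝ}
    (hd : ∀ u : ℂ, ‖u‖ < r → DifferentiableAt ℂ A u)
    (hc : ∀ u : ℂ, ‖u‖ < r → A (conj u) = conj (A u)) {u : ℂ} (hu : ‖u‖ < r) :
    deriv A (conj u) = conj (deriv A u) := by
  have h1 := (hd u hu).hasDerivAt.conj_conj
  have h2 : A =ᶠ[𝓝 (conj u)] conj ∘ A ∘ conj := by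
    have : ‖conj u‖ < r := by rwa [RCLike.norm_conj]
    filter_upwards [continuous_norm.continuousAt.eventually_lt continuousAt_const this] with x hx
    simp [hc x hx]
  exact (h1.congr_of_eventuallyEq h2).deriv

/-- Rescaled germs of functions which are real on the real axis and have positive derivative at `0`
are close to the identity. -/
lemma exists_nearIdentity {A : ℂ → ℂ} (hA : AnalyticAt ℂ A 0)
    (hconj : ∀ᶠ v in 𝓝 0, A (conj v) = conj (A v)) {s : ℝ} (hs : 0 < s)
    (hA' : deriv A 0 = s) :
    ∃ η : ℝ, 0 < η ∧ NearIdentity fun u => A (η * u) / (s * η) := by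
  obtain ⟨K, t, ht, hK⟩ := (hA.deriv.contDiffAt (n := 1)).exists_lipschitzOnWith
  obtain ⟨B, hB⟩ : ∃ B : ℝ, ∀ᶠ v in 𝓝 0, ‖A v‖ ≤ B :=
    ⟨‖A 0‖ + 1, (hA.continuousAt.norm.eventually_lt continuousAt_const (lt_add_one _)).mono
      fun _ h => h.le⟩
  have hev : ∀ᶠ v in 𝓝 0, DifferentiableAt ℂ A v ∧ A (conj v) = conj (A v) ∧ v ∈ t ∧ ‖A v‖ ≤ B :=
    (hA.eventually_analyticAt.mono fun _ h => h.differentiableAt).and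
      (hconj.and ((show ∀ᶠ v in 𝓝 0, v ∈ t from ht).and hB))
  rw [Metric.eventually_nhds_iff] at hev
  obtain ⟨R, hR, hev⟩ := hev
  simp only [dist_zero_right] at hev
  have h0t : (0 : ℂ) ∈ t := mem_of_mem_nhds ht
  obtain ⟨η, hη, hηr⟩ : ∃ η : ℝ, 0 < η ∧ η ≤ min (R / 3) (s / (60 * (K + 1))) :=
    ⟨_, by positivity, le_rfl⟩
  have hηR : 3 * η ≤ R := by
    have := hηr.trans (min_le_left _ _)
    linarith
  have hηK : 60 * K * η ≤ s := by
    have h := hηr.trans (min_le_right _ _)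
    rw [le_div_iff₀ (by positivity)] at h
    nlinarith
  have hnorm : ∀ u : ℂ, ‖(η : ℂ) * u‖ = η * ‖u‖ := fun u => by simp [abs_of_pos hη]
  have hsmall : ∀ u : ℂ, ‖u‖ < 3 → ‖(η : ℂ) * u‖ < R := fun u hu => by
    rw [hnorm]
    nlinarith
  have hη' : (η : ℂ) ≠ 0 := by exact_mod_cast hη.ne'
  have hs' : (s : ℂ) ≠ 0 := by exact_mod_cast hs.ne'
  have hder : ∀ u : ℂ, ‖u‖ < 3 →
      HasDerivAt (fun u => A (η * u) / (s * η)) (deriv A (η * u) / s) u := by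
    intro u hu
    have h1 : HasDerivAt (fun u : ℂ => η * u) η u := by
      simpa using (hasDerivAt_id u).const_mul (η : ℂ)
    have h2 := ((hev (hsmall u hu)).1.hasDerivAt.comp u h1).div_const (s * η)
    convert! h2 using 1
    field_simp
  have hcs : ∀ u : ℂ, ‖u‖ < 3 → conj ((η : ℂ) * u) = η * conj u := fun u _ => by simp
  refine ⟨η, hη, fun u hu => (hder u hu).differentiableAt, fun u hu => ?_, fun u hu => ?_,
    fun u hu => ?_, B / (s * η), fun u hu => ?_⟩
  · rw [← hcs u hu, (hev (hsmall u hu)).2.1]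
    simp
  · rw [(hder u hu).deriv]
    have h1 := hK.dist_le_mul _ (hev (hsmall u hu)).2.2.1 _ h0t
    rw [hA', dist_zero_right, dist_eq_norm, hnorm] at h1
    have h2 := (Complex.abs_re_le_norm _).trans h1
    rw [sub_re, ofReal_re] at h2
    rw [div_ofReal_re, div_sub_one hs.ne', abs_div, abs_of_pos hs, div_le_iff₀ hs]
    refine h2.trans ?_
    have := K.coe_nonneg
    have h3 : (K : ℝ) * (η * ‖u‖) ≤ K * (η * 3) := by gcongr
    linarith
  · rw [(hder u hu).deriv]
    have hcu : ‖conj u‖ < 3 := by rwa [RCLike.norm_conj]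
    have h1 := hK.dist_le_mul _ (hev (hsmall u hu)).2.2.1 _ (hev (hsmall _ hcu)).2.2.1
    rw [← hcs u hu, deriv_conj_symm (fun u hu => (hev hu).1) (fun u hu => (hev hu).2.1)
      (hsmall u hu), dist_eq_norm, dist_eq_norm, Complex.sub_conj, Complex.sub_conj] at h1
    simp only [norm_mul, norm_real, norm_I, mul_one, im_ofReal_mul, Real.norm_eq_abs,
      abs_two, abs_of_pos hη] at h1
    rw [div_ofReal_im, abs_div, abs_of_pos hs, div_le_iff₀ hs]
    have := mul_le_mul_of_nonneg_right hηK (abs_nonneg u.im)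
    nlinarith [abs_nonneg u.im, K.coe_nonneg]
  · rw [norm_div, norm_mul, norm_real, norm_real, Real.norm_of_nonneg hs.le,
      Real.norm_of_nonneg hη.le]
    gcongr
    exact (hev (hsmall u hu)).2.2.2

/-- For large `p`, the germ `p A` is realized as the R-transform of a probability measure. -/
theorem exists_measure_of_germ {A : ℂ → ℂ} (hA : AnalyticAt ℂ A 0)
    (hconj : ∀ᶠ v in 𝓝 0, A (conj v) = conj (A v)) {s : ℝ} (hs : 0 < s)
    (hA' : deriv A 0 = s) :
    ∃ p : ℝ, 0 < p ∧ ∃ ω : Measure ℝ, IsProbabilityMeasure ω ∧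
      ∀ z ∈ UHP, (cauchyG ω z)⁻¹ + p * A (cauchyG ω z) = z := by
  obtain ⟨η, hη, h⟩ := exists_nearIdentity hA hconj hs hA'
  obtain ⟨ω, hω, hG⟩ := h.exists_measure
  obtain ⟨ν, hν, hGν⟩ := exists_cauchyG_dilation ω hη
  refine ⟨(s * η ^ 2)⁻¹, by positivity, ν, hν, fun z hz => ?_⟩
  have hη' : (η : ℂ) ≠ 0 := by exact_mod_cast hη.ne'
  have hs' : (s : ℂ) ≠ 0 := by exact_mod_cast hs.ne'
  have hz' : (η : ℂ) * z ∈ UHP := by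
    have := mul_pos hη (show 0 < z.im from hz)
    simpa [UHP] using this
  have h1 := (hG _ hz').2
  rw [hGν z hz]
  apply mul_left_cancel₀ hη'
  refine Eq.trans ?_ h1
  push_cast
  field_simp

end Dilation

section Cone

open Filter Topology ComplexConjugate Bornology

/-- The filter of nontangential approach to infinity in the upper half-plane. -/
def coneFilter : Filter ℂ := atTop.comap im ⊓ (𝓝 0).comap fun z => z.re / z.im

lemma eventually_coneFilter {P : ℂ → Prop} :
    (∀ᶠ z in coneFilter, P z) ↔ ∃ α M : ℝ, 0 < α ∧ 0 < M ∧ ∀ z ∈ tcone α M, P z := by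
  have hb := ((atTop_basis_Ioi' (0 : ℝ)).comap im).inf
    ((Metric.nhds_basis_ball (x := (0 : ℝ))).comap fun z : ℂ => z.re / z.im)
  rw [coneFilter, hb.eventually_iff]
  have key : ∀ α M : ℝ, 0 < M → ∀ z : ℂ, z ∈ im ⁻¹' Set.Ioi M ∩
      (fun z : ℂ => z.re / z.im) ⁻¹' Metric.ball 0 α ↔ z ∈ tcone α M := by
    intro α M hM z
    simp only [Set.mem_inter_iff, Set.mem_preimage, Set.mem_Ioi, Metric.mem_ball,
      dist_zero_right, Real.norm_eq_abs, tcone, Set.mem_ofPred_eq, abs_div]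
    rw [and_comm]
    refine and_congr_left fun h => ?_
    have hz : 0 < z.im := hM.trans h
    rw [abs_of_pos hz, div_lt_iff₀ hz]
  constructor
  · rintro ⟨⟨M, α⟩, ⟨hM, hα⟩, h⟩
    exact ⟨α, M, hα, hM, fun z hz => h ((key α M hM z).2 hz)⟩
  · rintro ⟨α, M, hα, hM, h⟩
    exact ⟨⟨M, α⟩, ⟨hM, hα⟩, fun z hz => h z ((key α M hM z).1 hz)⟩

lemma isVT_iff {μ : Measure ℝ} {φ : ℂ → ℂ} :
    IsVT μ φ ↔ ∀ᶠ z in coneFilter, φ (Ftr μ z) + Ftr μ z = z := eventually_coneFilter.symm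

lemma isTwoStateVT_iff {μt μ : Measure ℝ} {ψ : ℂ → ℂ} :
    IsTwoStateVT μt μ ψ ↔ ∀ᶠ z in coneFilter, ψ (Ftr μ z) + Ftr μt z = z :=
  eventually_coneFilter.symm

lemma tendsto_mul_I_coneFilter : Tendsto (fun y : ℝ => (y : ℂ) * I) atTop coneFilter := by
  rw [coneFilter, tendsto_inf, tendsto_comap_iff, tendsto_comap_iff]
  refine ⟨tendsto_id.congr fun y => by simp, ?_⟩
  simp [Function.comp_def]

instance : coneFilter.NeBot := tendsto_mul_I_coneFilter.neBot

lemma eventually_im_gt (K : ℝ) : ∀ᶠ z in coneFilter, K < z.im :=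
  (tendsto_comap.eventually (eventually_gt_atTop K)).filter_mono inf_le_left

lemma coneFilter_le_cobounded : coneFilter ≤ cobounded ℂ := by
  rw [← comap_norm_atTop, ← tendsto_iff_comap]
  exact tendsto_atTop_mono (fun z => (le_abs_self _).trans (abs_im_le_norm z))
    (tendsto_comap.mono_left inf_le_left)

lemma tendsto_coneFilter_of_norm_sub_le {f : ℂ → ℂ} {C : ℝ}
    (h : ∀ᶠ z in coneFilter, ‖f z - z‖ ≤ C) : Tendsto f coneFilter coneFilter := by
  intro s hs
  rw [mem_map]
  obtain ⟨α, M, hα, hM, hs⟩ := eventually_coneFilter.1 hs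
  have h1 : ∀ᶠ z in coneFilter, z ∈ tcone (α / 2) 1 :=
    eventually_coneFilter.2 ⟨_, _, by positivity, one_pos, fun _ h => h⟩
  filter_upwards [h, h1, eventually_im_gt (M + C), eventually_im_gt (2 * (C * (1 + α)) / α)]
    with z hz hz1 hz2 hz3
  refine hs _ ⟨?_, ?_⟩
  · have hr := (abs_re_le_norm _).trans hz
    have hi := (abs_im_le_norm _).trans hz
    rw [sub_re] at hr
    rw [sub_im] at hi
    rw [div_lt_iff₀ hα] at hz3
    have h2 := hz1.1
    have h3 := abs_sub_abs_le_abs_sub (f z).re z.re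
    have h4 := mul_le_mul_of_nonneg_left (abs_le.1 hi).1 hα.le
    nlinarith
  · have hi := (abs_im_le_norm _).trans hz
    rw [sub_im] at hi
    linarith [(abs_le.1 hi).1]

lemma tendsto_cobounded_of_norm_sub_le {f : ℂ → ℂ} {C : ℝ}
    (h : ∀ᶠ z in cobounded ℂ, ‖f z - z‖ ≤ C) : Tendsto f (cobounded ℂ) (cobounded ℂ) := by
  rw [← tendsto_norm_atTop_iff_cobounded]
  refine tendsto_atTop_mono' _ ?_
    (tendsto_atTop_add_const_right _ (-C) (tendsto_norm_cobounded_atTop (E := ℂ)))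
  filter_upwards [h] with z hz
  have := norm_sub_norm_le z (f z)
  rw [norm_sub_rev] at this
  linarith

lemma eventually_comp_inv {P : ℂ → Prop} (h : ∀ᶠ v in 𝓝 0, P v) :
    ∀ᶠ z in cobounded ℂ, P z⁻¹ := tendsto_inv₀_cobounded.eventually h

lemma eventually_eq_of_coneFilter {f g : ℂ → ℂ} (hf : AnalyticAt ℂ f 0)
    (hg : AnalyticAt ℂ g 0) (h : ∀ᶠ z in coneFilter, f z⁻¹ = g z⁻¹) : ∀ᶠ v in 𝓝 0, f v = g v := by
  rw [← hf.frequently_eq_iff_eventually_eq hg]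
  have : Tendsto (fun z : ℂ => z⁻¹) coneFilter (𝓝[≠] 0) := by
    rw [← inv_cobounded₀]
    exact (tendsto_map (f := fun z : ℂ => z⁻¹)).mono_left coneFilter_le_cobounded
  exact this.frequently h.frequently

lemma norm_comp_inv_le {A : ℂ → ℂ} (hA : ContinuousAt A 0) :
    ∀ᶠ z in cobounded ℂ, ‖A z⁻¹‖ ≤ ‖A 0‖ + 1 :=
  eventually_comp_inv <|
    (hA.norm.eventually_lt continuousAt_const (lt_add_one _)).mono fun _ h => h.le

lemma eqOn_of_coneFilter {f g : ℂ → ℂ} {K : ℝ} (hf : DifferentiableOn ℂ f {z | K < z.im})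
    (hg : DifferentiableOn ℂ g {z | K < z.im}) (h : ∀ᶠ z in coneFilter, f z = g z) :
    ∀ z : ℂ, K < z.im → f z = g z := by
  obtain ⟨α, M, hα, hM, h⟩ := eventually_coneFilter.1 h
  have ho (K : ℝ) : IsOpen {z : ℂ | K < z.im} := isOpen_lt continuous_const continuous_im
  set w : ℂ := ((max M K + 1 : ℝ) : ℂ) * I with hw
  have hwi : w.im = max M K + 1 := by rw [hw, im_ofReal_mul]; simp
  have hwr : w.re = 0 := by rw [hw, re_ofReal_mul]; simp
  have hwM : M < w.im := by rw [hwi]; linarith [le_max_left M K]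
  have hwK : K < w.im := by rw [hwi]; linarith [le_max_right M K]
  have hev : f =ᶠ[𝓝 w] g := by
    have h1 : ∀ᶠ z in 𝓝 w, |z.re| < α * z.im ∧ M < z.im := by
      refine ContinuousAt.eventually_lt (by fun_prop) (by fun_prop) ?_ |>.and
        (ContinuousAt.eventually_lt (by fun_prop) (by fun_prop) hwM)
      rw [hwr, abs_zero]
      exact mul_pos hα (hM.trans hwM)
    exact h1.mono fun z hz => h z hz
  exact (hf.analyticOnNhd (ho K)).eqOn_of_preconnected_of_eventuallyEq
    (hg.analyticOnNhd (ho K)) (convex_im_gt K).isPreconnected hwK hev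

end Cone

section Germs

open Filter Topology ComplexConjugate Bornology

/-- The germ of `w ↦ w + A (1 / w)` at infinity, in the variable `v = 1 / w`. -/
def shiftGerm (A : ℂ → ℂ) (v : ℂ) : ℂ := v * (1 + v * A v)⁻¹

@[simp] lemma shiftGerm_zero (A : ℂ → ℂ) : shiftGerm A 0 = 0 := by simp [shiftGerm]

lemma shiftGerm_inv (A : ℂ → ℂ) {w : ℂ} (hw : w ≠ 0) :
    shiftGerm A w⁻¹ = (w + A w⁻¹)⁻¹ := by
  rw [shiftGerm, ← mul_inv]
  congr 1
  field_simp

lemma analyticAt_shiftGerm {A : ℂ → ℂ} (hA : AnalyticAt ℂ A 0) :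
    AnalyticAt ℂ (shiftGerm A) 0 :=
  analyticAt_id.mul ((analyticAt_const.add (analyticAt_id.mul hA)).inv (by simp))

lemma hasDerivAt_shiftGerm {A : ℂ → ℂ} (hA : AnalyticAt ℂ A 0) :
    HasDerivAt (shiftGerm A) 1 0 := by
  have h := (hasDerivAt_id (0 : ℂ)).mul (((hasDerivAt_const (0 : ℂ) (1 : ℂ)).add
    ((hasDerivAt_id (0 : ℂ)).mul hA.differentiableAt.hasDerivAt)).inv (by simp))
  convert! h using 1
  simp

lemma tendsto_conj_zero : Tendsto (conj : ℂ → ℂ) (𝓝 0) (𝓝 0) := by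
  simpa using continuous_conj.tendsto (0 : ℂ)

lemma shiftGerm_conj {A : ℂ → ℂ} (hA : ∀ᶠ v in 𝓝 0, A (conj v) = conj (A v)) :
    ∀ᶠ v in 𝓝 0, shiftGerm A (conj v) = conj (shiftGerm A v) :=
  hA.mono fun v hv => by simp [shiftGerm, hv]

lemma exists_local_inverse {f : ℂ → ℂ} (hf : AnalyticAt ℂ f 0) (h0 : f 0 = 0)
    (hf' : HasDerivAt f 1 0) (hc : ∀ᶠ v in 𝓝 0, f (conj v) = conj (f v)) :
    ∃ κ : ℂ → ℂ, AnalyticAt ℂ κ 0 ∧ κ 0 = 0 ∧ HasDerivAt κ 1 0 ∧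
      (∀ᶠ v in 𝓝 0, κ (f v) = v) ∧ (∀ᶠ v in 𝓝 0, f (κ v) = v) ∧
      ∀ᶠ v in 𝓝 0, κ (conj v) = conj (κ v) := by
  have hd : deriv f 0 ≠ 0 := by
    rw [hf'.deriv]
    exact one_ne_zero
  have hs := hf.hasStrictDerivAt
  set κ := hs.localInverse f _ 0 hd with hκ
  have hl : ∀ᶠ v in 𝓝 0, κ (f v) = v := hs.eventually_left_inverse hd
  have hr : ∀ᶠ v in 𝓝 0, f (κ v) = v := by
    have := hs.eventually_right_inverse hd
    rwa [h0] at this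
  have hκ0 : κ 0 = 0 := by
    have := hl.self_of_nhds
    rwa [h0] at this
  have hκa : AnalyticAt ℂ κ 0 := by
    have := hf.analyticAt_localInverse hd
    rwa [h0] at this
  have hκ' : HasDerivAt κ 1 0 := by
    have := (hs.to_localInverse hd).hasDerivAt
    rw [h0] at this
    simpa [hf'.deriv] using this
  have htκ : Tendsto κ (𝓝 0) (𝓝 0) := by simpa [hκ0] using hκa.continuousAt.tendsto
  refine ⟨κ, hκa, hκ0, hκ', hl, hr, ?_⟩
  filter_upwards [htκ.eventually hc, hr, (tendsto_conj_zero.comp htκ).eventually hl] with v h1 h2 h3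
  rw [Function.comp_apply, h1, h2] at h3
  exact h3

/-- Inverting `z ↦ z - e (1 / z)` near infinity. -/
lemma exists_inverse_germ {e : ℂ → ℂ} (he : AnalyticAt ℂ e 0)
    (hc : ∀ᶠ v in 𝓝 0, e (conj v) = conj (e v)) :
    ∃ A : ℂ → ℂ, AnalyticAt ℂ A 0 ∧ A 0 = e 0 ∧ deriv A 0 = deriv e 0 ∧
      (∀ᶠ v in 𝓝 0, A (conj v) = conj (A v)) ∧
      (∀ᶠ z in cobounded ℂ, A (z - e z⁻¹)⁻¹ = e z⁻¹) ∧
      ∀ᶠ w in cobounded ℂ, e (w + A w⁻¹)⁻¹ = A w⁻¹ := by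
  have hne : AnalyticAt ℂ (-e) 0 := he.neg
  have hnc : ∀ᶠ v in 𝓝 0, (-e) (conj v) = conj ((-e) v) := hc.mono fun v hv => by simp [hv]
  obtain ⟨κ, hκ, hκ0, hκ', hl, hr, hκc⟩ := exists_local_inverse (analyticAt_shiftGerm hne)
    (shiftGerm_zero _) (hasDerivAt_shiftGerm hne) (shiftGerm_conj hnc)
  have htκ : Tendsto κ (𝓝 0) (𝓝 0) := by simpa [hκ0] using hκ.continuousAt.tendsto
  have heκ : AnalyticAt ℂ e (κ 0) := by rwa [hκ0]
  refine ⟨e ∘ κ, heκ.comp hκ, by simp [hκ0], ?_, ?_, ?_, ?_⟩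
  · have := heκ.differentiableAt.hasDerivAt.comp (0 : ℂ) hκ'
    rw [this.deriv, hκ0, mul_one]
  · filter_upwards [hκc, htκ.eventually hc] with v h1 h2
    simp [h1, h2]
  · filter_upwards [eventually_comp_inv hl, eventually_ne_cobounded 0] with z h1 hz
    rw [shiftGerm_inv _ hz] at h1
    rw [sub_eq_add_neg, Function.comp_apply]
    exact congrArg e h1
  · have hκne : ∀ᶠ v in 𝓝[≠] (0 : ℂ), κ v ≠ 0 := by
      have := hκ'.eventually_ne (c := 0) one_ne_zero
      simpa using this
    have hr' : ∀ᶠ w in cobounded ℂ, shiftGerm (-e) (κ w⁻¹) = w⁻¹ ∧ κ w⁻¹ ≠ 0 := by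
      have := (hr.filter_mono nhdsWithin_le_nhds).and hκne
      exact (tendsto_inv₀_cobounded' (α := ℂ)).eventually this
    filter_upwards [hr'] with w ⟨h1, h2⟩
    have h3 := shiftGerm_inv (-e) (inv_ne_zero h2)
    rw [inv_inv, h1, inv_inj, Pi.neg_apply, ← sub_eq_add_neg] at h3
    have h4 : w + e (κ w⁻¹) = (κ w⁻¹)⁻¹ := by linear_combination h3
    rw [Function.comp_apply, h4, inv_inv]

end Germs

section MomentGerm

open Filter Topology ComplexConjugate Bornology ProbabilityTheory

lemma tendsto_mul_comp_inv {f : ℂ → ℂ} {c : ℂ} (hf : HasDerivAt f c 0) (h0 : f 0 = 0) :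
    Tendsto (fun y : ℝ => (y : ℂ) * I * f (y * I)⁻¹) atTop (𝓝 c) := by
  have h1 := hf.tendsto_slope.comp ((tendsto_inv₀_cobounded' (α := ℂ)).comp
    (tendsto_mul_I_coneFilter.mono_right coneFilter_le_cobounded))
  refine h1.congr fun y => ?_
  simp [slope_def_field, h0, div_eq_inv_mul]

/-- The moment generating function `∑ m_{j+k} v^k` of a compactly supported measure. -/
def momentGerm (μ : Measure ℝ) (j : ℕ) (v : ℂ) : ℂ := ∫ x : ℝ, (x : ℂ) ^ j * (1 - x * v)⁻¹ ∂μ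

lemma ae_abs_le_of_Icc {μ : Measure ℝ} [IsProbabilityMeasure μ] {R : ℝ}
    (h : μ (Set.Icc (-R) R) = 1) : ∀ᵐ x ∂μ, |x| ≤ R := by
  have := (mem_ae_iff_prob_eq_one measurableSet_Icc).2 h
  filter_upwards [this] with x hx
  exact abs_le.2 hx

lemma half_le_norm_one_sub {R x : ℝ} {v : ℂ} (hR : 0 < R) (hx : |x| ≤ R) (hv : ‖v‖ < (2 * R)⁻¹) :
    1 / 2 ≤ ‖1 - (x : ℂ) * v‖ := by
  have h1 : ‖(x : ℂ) * v‖ ≤ R * (2 * R)⁻¹ := by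
    rw [norm_mul, norm_real, Real.norm_eq_abs]
    gcongr
  have h2 : R * (2 * R)⁻¹ = 1 / 2 := by field_simp
  have h3 := norm_sub_norm_le (1 : ℂ) (x * v)
  rw [norm_one] at h3
  linarith

lemma norm_inv_one_sub_le {R x : ℝ} {v : ℂ} (hR : 0 < R) (hx : |x| ≤ R) (hv : ‖v‖ < (2 * R)⁻¹) :
    ‖(1 - (x : ℂ) * v)⁻¹‖ ≤ 2 := by
  rw [norm_inv]
  refine inv_le_of_inv_le₀ two_pos ?_
  simpa using half_le_norm_one_sub hR hx hv

lemma momentGerm_conj (μ : Measure ℝ) (j : ℕ) (v : ℂ) :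
    momentGerm μ j (conj v) = conj (momentGerm μ j v) := by
  rw [momentGerm, momentGerm, ← integral_conj]
  congr 1
  ext x
  simp

lemma cauchyG_eq_momentGerm (μ : Measure ℝ) {z : ℂ} (hz : z ≠ 0) :
    cauchyG μ z = z⁻¹ * momentGerm μ 0 z⁻¹ := by
  rw [cauchyG, momentGerm, ← integral_const_mul]
  congr 1
  ext x
  rw [pow_zero, one_mul, ← mul_inv]
  congr 1
  field_simp

variable {μ : Measure ℝ} [IsProbabilityMeasure μ] {R : ℝ}

lemma measurable_momentGerm_integrand (j : ℕ) (v : ℂ) :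
    Measurable fun x : ℝ => (x : ℂ) ^ j * (1 - x * v)⁻¹ := by fun_prop

lemma integrable_momentGerm_integrand (hR : 0 < R) (h : ∀ᵐ x ∂μ, |x| ≤ R) (j : ℕ) {v : ℂ}
    (hv : ‖v‖ < (2 * R)⁻¹) : Integrable (fun x : ℝ => (x : ℂ) ^ j * (1 - x * v)⁻¹) μ := by
  refine Integrable.of_bound (measurable_momentGerm_integrand j v).aestronglyMeasurable
    (R ^ j * 2) ?_
  filter_upwards [h] with x hx
  rw [norm_mul, norm_pow, norm_real, Real.norm_eq_abs]
  gcongr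
  exact norm_inv_one_sub_le hR hx hv

lemma hasDerivAt_momentGerm (hR : 0 < R) (h : ∀ᵐ x ∂μ, |x| ≤ R) (j : ℕ) {v : ℂ}
    (hv : ‖v‖ < (2 * R)⁻¹) :
    HasDerivAt (momentGerm μ j) (∫ x : ℝ, (x : ℂ) ^ (j + 1) * ((1 - x * v)⁻¹) ^ 2 ∂μ) v := by
  have hb : Metric.ball (0 : ℂ) (2 * R)⁻¹ ∈ 𝓝 v :=
    Metric.isOpen_ball.mem_nhds (by simpa using hv)
  refine (hasDerivAt_integral_of_dominated_loc_of_deriv_le hb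
    (F' := fun v x => (x : ℂ) ^ (j + 1) * ((1 - x * v)⁻¹) ^ 2)
    (bound := fun _ => R ^ (j + 1) * 2 ^ 2)
    (Eventually.of_forall fun v => (measurable_momentGerm_integrand j v).aestronglyMeasurable)
    (integrable_momentGerm_integrand hR h j hv)
    (Measurable.aestronglyMeasurable (by fun_prop)) ?_ (integrable_const _) ?_).2
  · filter_upwards [h] with x hx w hw
    rw [norm_mul, norm_pow, norm_pow, norm_real, Real.norm_eq_abs]
    gcongr
    exact norm_inv_one_sub_le hR hx (by simpa using hw)
  · filter_upwards [h] with x hx w hw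
    have hne : 1 - (x : ℂ) * w ≠ 0 := by
      rw [← norm_pos_iff]
      linarith [half_le_norm_one_sub hR hx (by simpa using hw : ‖w‖ < (2 * R)⁻¹)]
    have h1 : HasDerivAt (fun w : ℂ => 1 - (x : ℂ) * w) (-x) w := by
      simpa using ((hasDerivAt_id w).const_mul (x : ℂ)).const_sub 1
    convert! (h1.inv hne).const_mul ((x : ℂ) ^ j) using 1
    field_simp
    ring

lemma analyticAt_momentGerm (hR : 0 < R) (h : ∀ᵐ x ∂μ, |x| ≤ R) (j : ℕ) :
    AnalyticAt ℂ (momentGerm μ j) 0 := by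
  refine DifferentiableOn.analyticAt (s := Metric.ball 0 (2 * R)⁻¹) (fun v hv => ?_)
    (Metric.ball_mem_nhds _ (by positivity))
  exact (hasDerivAt_momentGerm hR h j (by simpa using hv)).differentiableAt.differentiableWithinAt

lemma momentGerm_eq_add (hR : 0 < R) (h : ∀ᵐ x ∂μ, |x| ≤ R) {v : ℂ} (hv : ‖v‖ < (2 * R)⁻¹) :
    momentGerm μ 0 v = 1 + v * momentGerm μ 1 v := by
  have h1 : ∫ _ : ℝ, (1 : ℂ) ∂μ = 1 := by simp
  rw [momentGerm, momentGerm, ← integral_const_mul]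
  nth_rewrite 2 [← h1]
  rw [← integral_add (integrable_const _)
    ((integrable_momentGerm_integrand hR h 1 hv).const_mul v)]
  refine integral_congr_ae ?_
  filter_upwards [h] with x hx
  have hne : 1 - (x : ℂ) * v ≠ 0 := by
    rw [← norm_pos_iff]
    linarith [half_le_norm_one_sub hR hx hv]
  field_simp
  ring

/-- Near infinity, the reciprocal Cauchy transform of a compactly supported measure is
`z - e (1 / z)` with `e` analytic at `0`. -/
lemma exists_germ (hR : 0 < R) (hμ : μ (Set.Icc (-R) R) = 1) :
    ∃ e : ℂ → ℂ, AnalyticAt ℂ e 0 ∧ e 0 = ((∫ x : ℝ, x ∂μ : ℝ) : ℂ) ∧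
      deriv e 0 = ((variance (fun x : ℝ => x) μ : ℝ) : ℂ) ∧
      (∀ᶠ v in 𝓝 0, e (conj v) = conj (e v)) ∧
      ∀ᶠ z in cobounded ℂ, Ftr μ z = z - e z⁻¹ := by
  have h := ae_abs_le_of_Icc hμ
  have hsmall : ‖(0 : ℂ)‖ < (2 * R)⁻¹ := by simpa using hR
  have h00 : momentGerm μ 0 0 = 1 := by simp [momentGerm]
  have h10 : momentGerm μ 1 0 = ((∫ x : ℝ, x ∂μ : ℝ) : ℂ) := by
    simpa [momentGerm] using integral_complex_ofReal (f := fun x : ℝ => x)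
  have h00' : momentGerm μ 0 0 ≠ 0 := by simp [h00]
  have ha := analyticAt_momentGerm hR h
  refine ⟨fun v => momentGerm μ 1 v / momentGerm μ 0 v, (ha 1).div (ha 0) h00', ?_, ?_, ?_, ?_⟩
  · simp [h00, h10]
  · have hd := (hasDerivAt_momentGerm hR h 1 hsmall).div (hasDerivAt_momentGerm hR h 0 hsmall) h00'
    have h2 : ∫ x : ℝ, (x : ℂ) ^ 2 ∂μ = ((∫ x : ℝ, x ^ 2 ∂μ : ℝ) : ℂ) := by
      rw [← integral_complex_ofReal]
      simp
    have hL : MemLp (fun x : ℝ => x) 2 μ :=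
      MemLp.of_bound measurable_id.aestronglyMeasurable R (by simpa using h)
    refine hd.deriv.trans ?_
    rw [variance_eq_sub hL]
    simp only [h00, h10, mul_zero, sub_zero, inv_one, one_pow, mul_one, zero_add, pow_one, div_one,
      one_add_one_eq_two, h2]
    rw [show ∫ x : ℝ, (x : ℂ) ∂μ = ((∫ x : ℝ, x ∂μ : ℝ) : ℂ) from integral_complex_ofReal]
    simp [sq]
  · exact Eventually.of_forall fun v => by simp [momentGerm_conj]
  · have hev : ∀ᶠ v in 𝓝 (0 : ℂ), ‖v‖ < (2 * R)⁻¹ ∧ momentGerm μ 0 v ≠ 0 :=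
      (continuous_norm.continuousAt.eventually_lt continuousAt_const hsmall).and
        ((ha 0).continuousAt.eventually_ne h00')
    filter_upwards [eventually_comp_inv hev, eventually_ne_cobounded 0] with z ⟨h1, h2⟩ hz
    have h3 := momentGerm_eq_add hR h h1
    rw [Ftr, cauchyG_eq_momentGerm μ hz, mul_inv, inv_inv, ← div_eq_mul_inv, eq_sub_iff_add_eq,
      ← add_div, div_eq_iff h2, h3]
    field_simp

/-- The measure `J[σ]` exists for every compactly supported `σ` of nonzero variance. -/
lemma exists_J (hR : 0 < R) (hμ : μ (Set.Icc (-R) R) = 1)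
    (hv : variance (fun x : ℝ => x) μ ≠ 0) :
    ∃ J : Measure ℝ, IsProbabilityMeasure J ∧ ∀ z ∈ UHP, Ftr μ z =
      z - ((∫ x : ℝ, x ∂μ : ℝ) : ℂ) -
        ((variance (fun x : ℝ => x) μ : ℝ) : ℂ) * cauchyG J z := by
  obtain ⟨e, he, he0, he', -, heF⟩ := exists_germ hR hμ
  set m : ℝ := ∫ x : ℝ, x ∂μ
  set v : ℝ := variance (fun x : ℝ => x) μ
  have hvpos : 0 < v := (variance_nonneg _ _).lt_of_ne' hv
  have hv' : (v : ℂ) ≠ 0 := by exact_mod_cast hv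
  have hval : ∀ᶠ z in cobounded ℂ, (z - m - Ftr μ z) / v = (e z⁻¹ - e 0) / v := by
    filter_upwards [heF] with z hz
    rw [hz, he0]
    ring
  have hbd : ∀ᶠ z in cobounded ℂ, ‖(z - m - Ftr μ z) / v‖ ≤ (‖e 0‖ + 1 + ‖e 0‖) / v := by
    filter_upwards [hval, norm_comp_inv_le he.continuousAt] with z h1 h2
    rw [h1, norm_div, norm_real, Real.norm_of_nonneg hvpos.le]
    gcongr
    exact (norm_sub_le _ _).trans (by gcongr)
  obtain ⟨r, -, hr⟩ := (hasBasis_cobounded_norm (E := ℂ)).eventually_iff.1 hbd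
  have him : ∀ z ∈ UHP, ((z - m - Ftr μ z) / v).im ≤ 0 := by
    intro z hz
    rw [div_ofReal_im]
    refine div_nonpos_of_nonpos_of_nonneg ?_ hvpos.le
    have := le_im_Ftr μ hz
    simp only [sub_im, ofReal_im]
    linarith
  have hlim : Tendsto (fun y : ℝ => (y : ℂ) * I * ((y * I - m - Ftr μ (y * I)) / v)) atTop
      (𝓝 1) := by
    have hd : HasDerivAt (fun u => (e u - e 0) / v) 1 0 := by
      simpa [he', hv'] using (he.differentiableAt.hasDerivAt.sub_const (e 0)).div_const (v : ℂ)
    refine (tendsto_mul_comp_inv hd (by simp)).congr' ?_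
    filter_upwards [(tendsto_mul_I_coneFilter.mono_right coneFilter_le_cobounded).eventually hval]
      with y hy
    rw [hy]
  obtain ⟨J, hJ, hG⟩ := exists_cauchyG_eq (G := fun z => (z - m - Ftr μ z) / v)
    (((differentiableOn_id.sub_const _).sub (differentiableOn_Ftr μ)).div_const _)
    him (fun z _ hz => hr hz) hlim
  refine ⟨J, hJ, fun z hz => ?_⟩
  rw [hG z hz]
  field_simp
  ring

end MomentGerm

section Transforms

open Filter Topology ComplexConjugate Bornology ProbabilityTheory

lemma tendsto_add_comp_inv_cobounded {A : ℂ → ℂ} (hA : ContinuousAt A 0) :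
    Tendsto (fun w => w + A w⁻¹) (cobounded ℂ) (cobounded ℂ) :=
  tendsto_cobounded_of_norm_sub_le (by simpa using norm_comp_inv_le hA)

lemma tendsto_add_comp_inv_coneFilter {A : ℂ → ℂ} (hA : ContinuousAt A 0) :
    Tendsto (fun w => w + A w⁻¹) coneFilter coneFilter :=
  tendsto_coneFilter_of_norm_sub_le
    (by simpa using (norm_comp_inv_le hA).filter_mono coneFilter_le_cobounded)

lemma IsVT.eventually_eq {μ : Measure ℝ} {φ A : ℂ → ℂ} (h : IsVT μ φ) (hA : AnalyticAt ℂ A 0)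
    (hF : ∀ᶠ w in cobounded ℂ, Ftr μ (w + A w⁻¹) = w) : ∀ᶠ w in coneFilter, φ w = A w⁻¹ := by
  filter_upwards [(tendsto_add_comp_inv_coneFilter hA.continuousAt).eventually (isVT_iff.1 h),
    hF.filter_mono coneFilter_le_cobounded] with w h1 h2
  rw [h2] at h1
  linear_combination h1

/-- Comparison of a two-state Voiculescu transform with the germs of its two components. -/
lemma IsTwoStateVT.eventually_eq {μt μ : Measure ℝ} {ψ A e : ℂ → ℂ} (h : IsTwoStateVT μt μ ψ)
    (hA : AnalyticAt ℂ A 0) (hF : ∀ᶠ w in cobounded ℂ, Ftr μ (w + A w⁻¹) = w)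
    (he : ∀ᶠ z in cobounded ℂ, Ftr μt z = z - e z⁻¹) :
    ∀ᶠ w in coneFilter, ψ w = e (shiftGerm A w⁻¹) := by
  have ht := tendsto_add_comp_inv_coneFilter hA.continuousAt
  filter_upwards [ht.eventually (isTwoStateVT_iff.1 h),
    hF.filter_mono coneFilter_le_cobounded,
    ht.eventually (he.filter_mono coneFilter_le_cobounded), eventually_im_gt 0] with w h1 h2 h3 h4
  have hw : w ≠ 0 := by
    rintro rfl
    simp at h4
  rw [h2, h3] at h1
  rw [shiftGerm_inv _ hw]
  linear_combination h1

variable {μ : Measure ℝ} [IsProbabilityMeasure μ] {R : ℝ}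

lemma tendsto_Ftr_coneFilter (hR : 0 < R) (hμ : μ (Set.Icc (-R) R) = 1) :
    Tendsto (Ftr μ) coneFilter coneFilter := by
  obtain ⟨e, he, -, -, -, heF⟩ := exists_germ hR hμ
  refine (tendsto_add_comp_inv_coneFilter he.neg.continuousAt).congr' ?_
  filter_upwards [heF.filter_mono coneFilter_le_cobounded] with z hz
  simp [hz, sub_eq_add_neg]

/-- The R-transform of a compactly supported measure, as an analytic germ. -/
lemma exists_rTransform (hR : 0 < R) (hμ : μ (Set.Icc (-R) R) = 1) :
    ∃ A : ℂ → ℂ, AnalyticAt ℂ A 0 ∧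
      deriv A 0 = ((variance (fun x : ℝ => x) μ : ℝ) : ℂ) ∧
      (∀ᶠ v in 𝓝 0, A (conj v) = conj (A v)) ∧
      (∀ᶠ z in cobounded ℂ, Ftr μ z + A (Ftr μ z)⁻¹ = z) ∧
      ∀ᶠ w in cobounded ℂ, Ftr μ (w + A w⁻¹) = w := by
  obtain ⟨e, he, -, he', hec, heF⟩ := exists_germ hR hμ
  obtain ⟨A, hA, -, hA', hAc, h1, h2⟩ := exists_inverse_germ he hec
  refine ⟨A, hA, hA'.trans he', hAc, ?_, ?_⟩
  · filter_upwards [heF, h1] with z hz h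
    rw [hz, h, sub_add_cancel]
  · filter_upwards [(tendsto_add_comp_inv_cobounded hA.continuousAt).eventually heF, h2] with w hw h
    rw [hw, h, add_sub_cancel_right]

/-- The R-transform of `μ` is determined by any Voiculescu transform of `μ`. -/
lemma rTransform_of_isVT (hR : 0 < R) (hμ : μ (Set.Icc (-R) R) = 1) {φ A : ℂ → ℂ}
    (h : IsVT μ φ) (hA : AnalyticAt ℂ A 0) (hφ : ∀ᶠ w in coneFilter, φ w = A w⁻¹) :
    (∀ᶠ z in cobounded ℂ, Ftr μ z + A (Ftr μ z)⁻¹ = z) ∧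
      ∀ᶠ w in cobounded ℂ, Ftr μ (w + A w⁻¹) = w := by
  obtain ⟨A', hA', -, -, h1, h2⟩ := exists_rTransform hR hμ
  obtain ⟨e, he, -, -, -, heF⟩ := exists_germ hR hμ
  have hF : Tendsto (Ftr μ) (cobounded ℂ) (cobounded ℂ) := by
    refine (tendsto_add_comp_inv_cobounded he.neg.continuousAt).congr' ?_
    filter_upwards [heF] with z hz
    simp [hz, sub_eq_add_neg]
  have heq : ∀ᶠ w in cobounded ℂ, A w⁻¹ = A' w⁻¹ := by
    refine eventually_comp_inv (P := fun v => A v = A' v) (eventually_eq_of_coneFilter hA hA' ?_)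
    filter_upwards [hφ, h.eventually_eq hA' h2] with w h3 h4
    rw [← h3, h4]
  constructor
  · filter_upwards [h1, hF.eventually heq] with z h3 h4
    rw [h4, h3]
  · filter_upwards [h2, heq] with w h3 h4
    rw [h4, h3]

/-- A measure which realizes a multiple of the germ `A ∘ κ` as its R-transform. -/
lemma exists_measure_comp (hμ : μ (Set.Icc (-R) R) = 1) {A κ : ℂ → ℂ}
    (hA : AnalyticAt ℂ A 0) (hA' : deriv A 0 = ((variance (fun x : ℝ => x) μ : ℝ) : ℂ))
    (hAc : ∀ᶠ v in 𝓝 0, A (conj v) = conj (A v))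
    (hF : ∀ᶠ w in cobounded ℂ, Ftr μ (w + A w⁻¹) = w)
    (hκ : AnalyticAt ℂ κ 0) (hκ0 : κ 0 = 0) (hκ' : HasDerivAt κ 1 0)
    (hκc : ∀ᶠ v in 𝓝 0, κ (conj v) = conj (κ v)) :
    ∃ p : ℝ, 0 < p ∧ ∃ ω : Measure ℝ, IsProbabilityMeasure ω ∧
      ∀ᶠ z in coneFilter, p * A (κ (Ftr ω z)⁻¹) + Ftr ω z = z := by
  have htκ : Tendsto κ (𝓝 0) (𝓝 0) := by simpa [hκ0] using hκ.continuousAt.tendsto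
  have hAκ : AnalyticAt ℂ A (κ 0) := by rwa [hκ0]
  rcases (variance_nonneg (fun x : ℝ => x) μ).eq_or_lt' with h0 | hpos
  · have hL : MemLp (fun x : ℝ => x) 2 μ :=
      MemLp.of_bound measurable_id.aestronglyMeasurable R (by simpa using ae_abs_le_of_Icc hμ)
    have hae : (fun x : ℝ => x) =ᵐ[μ] fun _ => ∫ x, x ∂μ := by
      refine (evariance_eq_zero_iff (X := fun x : ℝ => x) measurable_id.aemeasurable).1 ?_
      rw [← hL.ofReal_variance_eq, h0, ENNReal.ofReal_zero]
    set m : ℝ := ∫ x, x ∂μ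
    have hFμ : ∀ z, Ftr μ z = z - m := by
      intro z
      have : cauchyG μ z = ∫ _ : ℝ, (z - m)⁻¹ ∂μ := by
        refine integral_congr_ae ?_
        filter_upwards [hae] with x hx
        rw [hx]
      rw [Ftr, this]
      simp
    have hAm : ∀ᶠ v in 𝓝 0, A v = m := by
      refine eventually_eq_of_coneFilter (g := fun _ => (m : ℂ)) hA analyticAt_const ?_
      filter_upwards [hF.filter_mono coneFilter_le_cobounded] with w hw
      rw [hFμ] at hw
      linear_combination hw
    refine ⟨1, one_pos, Measure.dirac m, inferInstance, ?_⟩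
    have hFω : ∀ z, Ftr (Measure.dirac m) z = z + -m := by
      intro z
      simp [Ftr, cauchyG, sub_eq_add_neg]
    have ht := tendsto_add_comp_inv_cobounded (A := fun _ => -(m : ℂ)) continuousAt_const
    filter_upwards [(ht.eventually (eventually_comp_inv (htκ.eventually hAm))).filter_mono
      coneFilter_le_cobounded] with z hz
    rw [hFω, hz]
    simp
  · obtain ⟨p, hp, ω, hω, h⟩ := exists_measure_of_germ (A := A ∘ κ) (hAκ.comp hκ)
      (by
        filter_upwards [hκc, htκ.eventually hAc] with v h1 h2
        simp [h1, h2]) hpos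
      (by rw [(hAκ.differentiableAt.hasDerivAt.comp (0 : ℂ) hκ').deriv, hκ0, mul_one, hA'])
    refine ⟨p, hp, ω, hω, ?_⟩
    filter_upwards [eventually_im_gt 0] with z hz
    rw [Ftr, inv_inv, add_comm]
    exact h z hz

/-- A weak limit of measures whose Cauchy transforms are small perturbations of `C (1 / w)`. -/
lemma exists_measure_of_perturbation {A C : ℂ → ℂ} (hA : AnalyticAt ℂ A 0) (hC : AnalyticAt ℂ C 0)
    (hC0 : C 0 = 0) (hC' : HasDerivAt C 1 0) (ν : ℕ → Measure ℝ)
    [∀ n, IsProbabilityMeasure (ν n)]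
    (h : ∀ n : ℕ, ∀ᶠ w in coneFilter,
      cauchyG (ν n) (w + ((1 / (n + 1 : ℝ) : ℝ) : ℂ) * A w⁻¹) = C w⁻¹) :
    ∃ ρ : Measure ℝ, IsProbabilityMeasure ρ ∧ ∀ᶠ w in coneFilter, cauchyG ρ w = C w⁻¹ := by
  set M := ‖A 0‖ + 1 with hM
  have hM0 : 0 < M := by positivity
  have hev : ∀ᶠ v in 𝓝 (0 : ℂ), AnalyticAt ℂ A v ∧ AnalyticAt ℂ C v ∧ ‖A v‖ ≤ M :=
    hA.eventually_analyticAt.and (hC.eventually_analyticAt.and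
      ((hA.continuousAt.norm.eventually_lt continuousAt_const (lt_add_one _)).mono
        fun _ h => h.le))
  obtain ⟨r, hr, hev⟩ := Metric.eventually_nhds_iff.1 hev
  simp only [dist_zero_right] at hev
  set K := max r⁻¹ (M + 1) with hK
  have hK1 : M + 1 ≤ K := le_max_right _ _
  have hK0 : 0 < K := by linarith
  have hw0 : ∀ w : ℂ, K < w.im → w ≠ 0 := by
    rintro w hw rfl
    simp only [zero_im] at hw
    linarith
  have hin : ∀ w : ℂ, K < w.im → ‖w⁻¹‖ < r := by
    intro w hw
    rw [norm_inv]
    refine inv_lt_of_inv_lt₀ hr ((le_max_left _ _).trans_lt (hw.trans_le ?_))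
    exact (le_abs_self _).trans (abs_im_le_norm w)
  have ht0 : ∀ n : ℕ, 0 < 1 / (n + 1 : ℝ) := fun n => by positivity
  have ht1 : ∀ n : ℕ, 1 / (n + 1 : ℝ) ≤ 1 := fun n => by
    rw [div_le_one (by positivity)]
    linarith [n.cast_nonneg (α := ℝ)]
  have hsmall : ∀ (n : ℕ) (w : ℂ), K < w.im →
      ‖((1 / (n + 1 : ℝ) : ℝ) : ℂ) * A w⁻¹‖ ≤ 1 / (n + 1 : ℝ) * M := by
    intro n w hw
    rw [norm_mul, norm_real, Real.norm_of_nonneg (ht0 n).le]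
    exact mul_le_mul_of_nonneg_left (hev (hin w hw)).2.2 (ht0 n).le
  have him : ∀ (n : ℕ) (w : ℂ), K < w.im →
      1 < (w + ((1 / (n + 1 : ℝ) : ℝ) : ℂ) * A w⁻¹).im := by
    intro n w hw
    have h1 := (abs_im_le_norm _).trans (hsmall n w hw)
    have h2 := mul_le_mul_of_nonneg_right (ht1 n) hM0.le
    rw [add_im]
    linarith [(abs_le.1 h1).1]
  have hdinv : ∀ {f : ℂ → ℂ} {w : ℂ}, w ≠ 0 → AnalyticAt ℂ f w⁻¹ →
      DifferentiableAt ℂ (fun w => f w⁻¹) w := fun hw hf =>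
    hf.differentiableAt.comp _ (differentiableAt_inv hw)
  have heq : ∀ (n : ℕ) (w : ℂ), K < w.im →
      cauchyG (ν n) (w + ((1 / (n + 1 : ℝ) : ℝ) : ℂ) * A w⁻¹) = C w⁻¹ := by
    intro n
    refine eqOn_of_coneFilter (fun w hw => ?_) (fun w hw => ?_) (h n)
    · refine DifferentiableAt.differentiableWithinAt ?_
      have h1 := differentiableAt_cauchyG (ν n) (zero_lt_one.trans (him n w hw)).ne'
      exact DifferentiableAt.comp (g := cauchyG (ν n)) w h1 (differentiableAt_id.add
        ((hdinv (hw0 w hw) (hev (hin w hw)).1).const_mul _))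
    · exact (hdinv (hw0 w hw) (hev (hin w hw)).2.1).differentiableWithinAt
  have hlim : ∀ w : ℂ, K < w.im → Tendsto (fun n => cauchyG (ν n) w) atTop (𝓝 (C w⁻¹)) := by
    intro w hw
    have hw1 : 0 < w.im := hK0.trans hw
    rw [tendsto_iff_norm_sub_tendsto_zero]
    have ht : Tendsto (fun n : ℕ => 1 / (n + 1 : ℝ) * M * w.im⁻¹) atTop (𝓝 0) := by
      simpa using (tendsto_one_div_add_atTop_nhds_zero_nat.mul_const M).mul_const w.im⁻¹
    refine squeeze_zero (fun _ => norm_nonneg _) (fun n => ?_) ht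
    rw [← heq n w hw, norm_sub_rev]
    have h1 := him n w hw
    refine (norm_cauchyG_sub_le (ν n) (zero_lt_one.trans h1) hw1).trans ?_
    rw [add_sub_cancel_left]
    refine mul_le_mul (hsmall n w hw) ?_ (by positivity) (by positivity)
    exact mul_le_of_le_one_left (by positivity) (inv_le_one_of_one_le₀ h1.le)
  obtain ⟨ρ, hρ, hG⟩ := exists_limit_measure ν (fun w => C w⁻¹) hK0.le hlim
    (tendsto_mul_comp_inv hC' hC0)
  exact ⟨ρ, hρ, (eventually_im_gt K).mono hG⟩

end Transforms

open Filter Topology ComplexConjugate Bornology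

/-- (Converse.) Let `{(tμ t, μ t)}` be a two-state free convolution semigroup
of compactly supported probability measures (free part generated by `φ1`, two-state part by
`ψ`), with `Var[tμ 1] ≠ 0`. Then there are `p > 0` and probability measures `ω, tρ` such that
`sub = ω ⊳ tρ` is ⊞-infinitely divisible with `μ t = sub^{⊞(t/p)}`, and for `t > 0`,
`J[tμ t]` is the probability measure with Voiculescu transform `φ_{tρ} + (t/p)·φ_ω`. -/
theorem stmt8
    (μ tμ : ℝ → Measure ℝ)
    (hprob : ∀ t : ℝ, 0 ≤ t → IsProbabilityMeasure (μ t) ∧ IsProbabilityMeasure (tμ t))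
    (hcompact : ∀ t : ℝ, 0 ≤ t → ∃ R : ℝ, 0 < R ∧
      μ t (Set.Icc (-R) R) = 1 ∧ tμ t (Set.Icc (-R) R) = 1)
    (φ1 ψ : ℂ → ℂ)
    (hsemi : ∀ t : ℝ, 0 ≤ t → IsVT (μ t) (fun z => (t : ℂ) * φ1 z))
    (h2semi : ∀ t : ℝ, 0 ≤ t → IsTwoStateVT (tμ t) (μ t) (fun z => (t : ℂ) * ψ z))
    (hvar : ProbabilityTheory.variance (fun x : ℝ => x) (tμ 1) ≠ 0) :
    ∃ p : ℝ, 0 < p ∧ ∃ ω tρ : Measure ℝ,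
      IsProbabilityMeasure ω ∧ IsProbabilityMeasure tρ ∧
      ∃ φω φρ : ℂ → ℂ, IsVT ω φω ∧ IsVT tρ φρ ∧
      ∃ conv sub : Measure ℝ, IsProbabilityMeasure conv ∧ IsProbabilityMeasure sub ∧
        IsVT conv (fun z => φω z + φρ z) ∧
        (∀ z ∈ UHP, cauchyG conv z = cauchyG tρ (Ftr sub z)) ∧
        (∃ φs : ℂ → ℂ, IsVT sub φs ∧
          ∀ t : ℝ, 0 ≤ t → IsVT (μ t) (fun z => ((t / p : ℝ) : ℂ) * φs z)) ∧
        (∀ t : ℝ, 0 < t → ∃ m : Measure ℝ, IsProbabilityMeasure m ∧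
          IsVT m (fun z => φρ z + ((t / p : ℝ) : ℂ) * φω z) ∧
          ∀ z ∈ UHP, Ftr (tμ t) z =
            z - ((∫ x : ℝ, x ∂(tμ t) : ℝ) : ℂ)
              - ((ProbabilityTheory.variance (fun x : ℝ => x) (tμ t) : ℝ) : ℂ)
                * cauchyG m z) := by

  choose! R hR hRμ hRσ using hcompact
  obtain ⟨hμ1, hσ1⟩ := hprob 1 zero_le_one
  obtain ⟨A, hA, hA', hAc, -, hFA⟩ := exists_rTransform (hR 1 zero_le_one) (hRμ 1 zero_le_one)
  have hφ : ∀ᶠ w in coneFilter, φ1 w = A w⁻¹ := by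
    simpa using (hsemi 1 zero_le_one).eventually_eq hA hFA
  have hAt : ∀ t : ℝ, AnalyticAt ℂ (fun v => (t : ℂ) * A v) 0 := fun t => analyticAt_const.mul hA
  have hF : ∀ t : ℝ, 0 ≤ t → (∀ᶠ z in cobounded ℂ, Ftr (μ t) z + t * A (Ftr (μ t) z)⁻¹ = z) ∧
      ∀ᶠ w in cobounded ℂ, Ftr (μ t) (w + t * A w⁻¹) = w := by
    intro t ht
    have := (hprob t ht).1
    exact rTransform_of_isVT (hR t ht) (hRμ t ht) (hsemi t ht) (hAt t)
      (hφ.mono fun w hw => by rw [hw])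
  obtain ⟨e, he, he0, he', hec, heF⟩ := exists_germ (hR 1 zero_le_one) (hRσ 1 zero_le_one)
  set b : ℝ := ∫ x : ℝ, x ∂(tμ 1)
  set v : ℝ := ProbabilityTheory.variance (fun x : ℝ => x) (tμ 1)
  have hv : (v : ℂ) ≠ 0 := by exact_mod_cast hvar
  have heA : AnalyticAt ℂ e (shiftGerm A 0) := by rwa [shiftGerm_zero]
  have hB : AnalyticAt ℂ (fun u => e (shiftGerm A u)) 0 :=
    AnalyticAt.comp (g := e) heA (analyticAt_shiftGerm hA)
  have hB' : HasDerivAt (fun u => e (shiftGerm A u)) v 0 := by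
    have := heA.differentiableAt.hasDerivAt.comp (0 : ℂ) (hasDerivAt_shiftGerm hA)
    rwa [shiftGerm_zero, he', mul_one] at this
  have hψ : ∀ᶠ w in coneFilter, ψ w = e (shiftGerm A w⁻¹) := by
    have h := h2semi 1 zero_le_one
    simp only [ofReal_one, one_mul] at h
    exact h.eventually_eq hA hFA heF
  set C : ℂ → ℂ := fun u => (e (shiftGerm A u) - b) / v with hCdef
  have hC : AnalyticAt ℂ C 0 := (hB.sub analyticAt_const).div_const
  have hC0 : C 0 = 0 := by simp [hCdef, he0]
  have hC' : HasDerivAt C 1 0 := by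
    simpa [hv] using (hB'.sub_const (b : ℂ)).div_const (v : ℂ)
  have hCc : ∀ᶠ u in 𝓝 0, C (conj u) = conj (C u) := by
    have ht : Tendsto (shiftGerm A) (𝓝 0) (𝓝 0) := by
      simpa using (analyticAt_shiftGerm hA).continuousAt.tendsto
    filter_upwards [shiftGerm_conj hAc, ht.eventually hec] with u h1 h2
    simp [hCdef, h1, h2]
  -- the measures `J[tμ t]`
  have hJ : ∀ t : ℝ, 0 < t → ∃ m : Measure ℝ, IsProbabilityMeasure m ∧
      (∀ z ∈ UHP, Ftr (tμ t) z =
        z - ((∫ x : ℝ, x ∂(tμ t) : ℝ) : ℂ)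
          - ((ProbabilityTheory.variance (fun x : ℝ => x) (tμ t) : ℝ) : ℂ) * cauchyG m z) ∧
      ∀ᶠ w in coneFilter, cauchyG m (w + t * A w⁻¹) = C w⁻¹ := by
    intro t ht
    have := (hprob t ht.le).1
    have := (hprob t ht.le).2
    have ht' : (t : ℂ) ≠ 0 := by exact_mod_cast ht.ne'
    obtain ⟨et, het, het0, het', -, hetF⟩ := exists_germ (hR t ht.le) (hRσ t ht.le)
    have hsg := analyticAt_shiftGerm (hAt t)
    have h1 : ∀ᶠ w in coneFilter, t * ψ w = et (shiftGerm (fun v => (t : ℂ) * A v) w⁻¹) :=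
      (h2semi t ht.le).eventually_eq (hAt t) (hF t ht.le).2 hetF
    have hetA : AnalyticAt ℂ et (shiftGerm (fun v => (t : ℂ) * A v) 0) := by rwa [shiftGerm_zero]
    have h2 : ∀ᶠ u in 𝓝 0,
        (t : ℂ) * e (shiftGerm A u) = et (shiftGerm (fun v => (t : ℂ) * A v) u) := by
      refine eventually_eq_of_coneFilter (analyticAt_const.mul hB)
        (AnalyticAt.comp (g := et) hetA hsg) ?_
      filter_upwards [h1, hψ] with w h3 h4
      rw [← h4, h3]
    have hmean : ((∫ x : ℝ, x ∂(tμ t) : ℝ) : ℂ) = t * b := by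
      have := h2.self_of_nhds
      rw [shiftGerm_zero, shiftGerm_zero, he0, het0] at this
      exact this.symm
    have hvart : ((ProbabilityTheory.variance (fun x : ℝ => x) (tμ t) : ℝ) : ℂ) = t * v := by
      have h3 := hetA.differentiableAt.hasDerivAt.comp (0 : ℂ) (hasDerivAt_shiftGerm (hAt t))
      rw [shiftGerm_zero, het', mul_one] at h3
      exact h3.unique ((hB'.const_mul (t : ℂ)).congr_of_eventuallyEq (EventuallyEq.symm h2))
    have hne : ProbabilityTheory.variance (fun x : ℝ => x) (tμ t) ≠ 0 := by
      intro h
      rw [h, ofReal_zero] at hvart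
      exact mul_ne_zero ht' hv hvart.symm
    obtain ⟨m, hm, hmF⟩ := exists_J (hR t ht.le) (hRσ t ht.le) hne
    refine ⟨m, hm, hmF, ?_⟩
    have hcone := tendsto_add_comp_inv_coneFilter (hAt t).continuousAt
    filter_upwards [h1, hψ, hcone.eventually (hetF.filter_mono coneFilter_le_cobounded),
      hcone.eventually (eventually_im_gt 0), eventually_im_gt 0] with w h3 h4 h5 h6 h7
    have hw : w ≠ 0 := by
      rintro rfl
      simp at h7
    rw [h4, shiftGerm_inv (fun v => (t : ℂ) * A v) hw] at h3
    rw [hmF _ h6, ← h3, hmean, hvart] at h5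
    have h8 : (t : ℂ) * (v * cauchyG m (w + t * A w⁻¹)) =
        t * (e (shiftGerm A w⁻¹) - b) := by linear_combination -h5
    rw [hCdef, eq_div_iff hv, mul_comm]
    exact mul_left_cancel₀ ht' h8
  choose! J hJprob hJF hJC using hJ
  have hpos : ∀ n : ℕ, 0 < 1 / (n + 1 : ℝ) := fun n => by positivity
  have hJn : ∀ n : ℕ, IsProbabilityMeasure (J (1 / (n + 1 : ℝ))) := fun n => hJprob _ (hpos n)
  obtain ⟨ρ, hρ, hρC⟩ := exists_measure_of_perturbation hA hC hC0 hC'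
    (fun n : ℕ => J (1 / (n + 1 : ℝ))) fun n => hJC _ (hpos n)
  obtain ⟨κ, hκ, hκ0, hκ', hκC, -, hκc⟩ := exists_local_inverse hC hC0 hC' hCc
  obtain ⟨p, hp, ω, hω, hωA⟩ := exists_measure_comp (hRμ 1 zero_le_one) hA hA' hAc hFA
    hκ hκ0 hκ' hκc
  have hp' : (p : ℂ) ≠ 0 := by exact_mod_cast hp.ne'
  have hκC' : ∀ᶠ w in coneFilter, κ (C w⁻¹) = w⁻¹ :=
    (eventually_comp_inv hκC).filter_mono coneFilter_le_cobounded
  set φω : ℂ → ℂ := fun u => p * A (κ u⁻¹)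
  set φρ : ℂ → ℂ := fun u => (κ u⁻¹)⁻¹ - u
  have hcone : ∀ t : ℝ, 0 ≤ t → Tendsto (Ftr (μ t)) coneFilter coneFilter := by
    intro t ht
    have := (hprob t ht).1
    exact tendsto_Ftr_coneFilter (hR t ht) (hRμ t ht)
  have hJz : ∀ t : ℝ, 0 < t →
      ∀ᶠ z in coneFilter, cauchyG (J t) z = C (Ftr (μ t) z)⁻¹ := by
    intro t ht
    filter_upwards [(hcone t ht.le).eventually (hJC t ht),
      (hF t ht.le).1.filter_mono coneFilter_le_cobounded] with z h1 h2
    rwa [h2] at h1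
  have hJVT : ∀ t : ℝ, 0 < t → IsVT (J t) (fun z => φρ z + ((t / p : ℝ) : ℂ) * φω z) := by
    intro t ht
    rw [isVT_iff]
    filter_upwards [hJz t ht, (hcone t ht.le).eventually hκC',
      (hF t ht.le).1.filter_mono coneFilter_le_cobounded] with z h1 h2 h3
    simp only [φρ, φω, Ftr, inv_inv] at h1 h2 h3 ⊢
    rw [h1, h2]
    refine Eq.trans ?_ h3
    push_cast
    field_simp
    ring
  have := hJprob p hp
  have := (hprob p hp.le).1
  refine ⟨p, hp, ω, ρ, hω, hρ, φω, φρ, ?_, ?_, J p, μ p, hJprob p hp, (hprob p hp.le).1, ?_, ?_,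
    ⟨fun z => p * φ1 z, hsemi p hp.le, fun t ht => ?_⟩, fun t ht => ⟨J t, hJprob t ht, hJVT t ht,
      hJF t ht⟩⟩
  · exact isVT_iff.2 hωA
  · rw [isVT_iff]
    filter_upwards [hρC, hκC'] with w h1 h2
    simp only [φρ, Ftr, inv_inv]
    rw [h1, h2, inv_inv]
    ring
  · convert! hJVT p hp using 2 with z
    rw [div_self hp.ne', ofReal_one, one_mul, add_comm]
  · refine eqOn_of_coneFilter (differentiableOn_cauchyG _)
      ((differentiableOn_cauchyG ρ).comp (differentiableOn_Ftr (μ p)) fun z hz =>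
        Ftr_mem_UHP (μ p) hz) ?_
    filter_upwards [hJz p hp, (hcone p hp.le).eventually hρC] with z h1 h2
    rw [h1, h2]
  · convert! hsemi t ht using 2 with z
    push_cast
    field_simp
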